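/- arXiv:2605.15833 — 3 statements merged into one kernel-verified Lean document; each statement's English description precedes it below -/
import Mathlib

section
/- Let Δ, k, and n be natural numbers with k ≥ 1. Let 𝒢 be a Δ-temporally connected temporal graph on n vertices, and let T be a spanning tree of the underlying graph of 𝒢. If 𝒢 contains at least ⌈18k·ln(6k)⌉·(Δ + n/k) snapshots that are k-edge-deficient with respect to T, then 𝒢 can be explored from any vertex. -/
/-- A temporal walk from `v` to `u` in the temporal graph whose snapshots are
`G 0, …, G (L-1)` (0-indexed timeline of lifetime `L`): a sequence of vertices
together with strictly increasing time steps such that each consecutive pair of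
vertices is adjacent in the snapshot at the corresponding time. -/
def TWalk {V : Type*} {L : ℕ} (G : Fin L → SimpleGraph V) (v u : V) : Prop :=
  ∃ (ℓ : ℕ) (w : Fin (ℓ + 1) → V) (t : Fin ℓ → Fin L),
    StrictMono t ∧ w 0 = v ∧ w (Fin.last ℓ) = u ∧
    ∀ i : Fin ℓ, (G (t i)).Adj (w i.castSucc) (w i.succ)

/-- The temporal graph `G` can be explored from `v` by a temporal walk of length
exactly `ℓ`: the walk starts at `v` and visits all vertices. -/
def ExploresIn {V : Type*} {L : ℕ} (G : Fin L → SimpleGraph V) (v : V) (ℓ : ℕ) : Prop :=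
  ∃ (w : Fin (ℓ + 1) → V) (t : Fin ℓ → Fin L),
    StrictMono t ∧ w 0 = v ∧ (∀ x : V, ∃ i, w i = x) ∧
    ∀ i : Fin ℓ, (G (t i)).Adj (w i.castSucc) (w i.succ)

/-- The temporal graph `G` can be explored from `v` (within its lifetime; note that
any temporal walk automatically has length at most `L`). -/
def CanExploreFrom {V : Type*} {L : ℕ} (G : Fin L → SimpleGraph V) (v : V) : Prop :=
  ∃ ℓ : ℕ, ExploresIn G v ℓ

/-- `G` is temporally connected: for every ordered pair of vertices there is a
temporal walk from the first to the second. -/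
def TemporallyConnected {V : Type*} {L : ℕ} (G : Fin L → SimpleGraph V) : Prop :=
  ∀ v u : V, TWalk G v u

/-- `G` is `Δ`-temporally connected: every window of `Δ` consecutive snapshots is
temporally connected. -/
def DeltaTConnected {V : Type*} {L : ℕ} (Δ : ℕ) (G : Fin L → SimpleGraph V) : Prop :=
  ∀ a : ℕ, ∀ _ : a + Δ ≤ L,
    TemporallyConnected (fun i : Fin Δ => G ⟨a + i.val, by have := i.isLt; omega⟩)

/-- `T` is a spanning tree of the graph `U`. -/
def IsSpanningTree {V : Type*} (T U : SimpleGraph V) : Prop :=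
  T ≤ U ∧ T.IsTree

/-- The snapshot `H` is `k`-edge-deficient with respect to the graph `F`:
at most `k` edges of `F` are absent from `H`. -/
def KDeficientWrt {V : Type*} (F H : SimpleGraph V) (k : ℕ) : Prop :=
  (F.edgeSet \ H.edgeSet).ncard ≤ k

namespace KDefAux

/-- Lazy journeys: from `v` at time `a` to `u` at time `b`, visiting exactly `S`. -/
inductive J {V : Type*} {L : ℕ} (G : Fin L → SimpleGraph V) (a : ℕ) (v : V) :
    ℕ → V → Set V → Prop
  | refl : J G a v a v {v}
  | wait {b : ℕ} {u : V} {S : Set V} : J G a v b u S → J G a v (b + 1) u S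
  | step {b : ℕ} {u x : V} {S : Set V} (h : b < L) : J G a v b u S →
      (G ⟨b, h⟩).Adj u x → J G a v (b + 1) x (insert x S)

variable {V : Type*} {L : ℕ} {G : Fin L → SimpleGraph V}

theorem J.last_mem {a b : ℕ} {v u : V} {S : Set V} (h : J G a v b u S) : u ∈ S := by
  induction h with
  | refl => simp
  | wait _ ih => exact ih
  | step => simp

theorem J.waits {a b c : ℕ} {v u : V} {S : Set V} (h : J G a v b u S) (hbc : b ≤ c) :
    J G a v c u S := by
  induction c, hbc using Nat.le_induction with
  | base => exact h
  | succ c _ ih => exact ih.wait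

theorem J.trans {a b c : ℕ} {v u x : V} {S S' : Set V} (h : J G a v b u S)
    (h' : J G b u c x S') : J G a v c x (S ∪ S') := by
  induction h' with
  | refl =>
    have : S ∪ {u} = S := by simpa using h.last_mem
    rw [this]; exact h
  | wait _ ih => exact ih.wait
  | step hb _ hadj ih =>
    rw [Set.union_insert]
    exact ih.step hb hadj

theorem J.explore {a b : ℕ} {v u : V} {S : Set V} (h : J G a v b u S) :
    ∃ (ℓ : ℕ) (w : Fin (ℓ + 1) → V) (t : Fin ℓ → Fin L),
      StrictMono t ∧ w 0 = v ∧ w (Fin.last ℓ) = u ∧ (∀ x ∈ S, ∃ i, w i = x) ∧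
      (∀ i : Fin ℓ, (G (t i)).Adj (w i.castSucc) (w i.succ)) ∧ ∀ i, (t i).val < b := by
  induction h with
  | refl =>
    refine ⟨0, fun _ => v, Fin.elim0, fun i => i.elim0, rfl, rfl, ?_, fun i => i.elim0,
      fun i => i.elim0⟩
    intro x hx
    exact ⟨0, hx.symm⟩
  | wait _ ih =>
    obtain ⟨ℓ, w, t, h1, h2, h3, h4, h5, h6⟩ := ih
    exact ⟨ℓ, w, t, h1, h2, h3, h4, h5, fun i => (h6 i).trans (Nat.lt_succ_self _)⟩
  | @step b u x S hb _ hadj ih =>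
    obtain ⟨ℓ, w, t, h1, h2, h3, h4, h5, h6⟩ := ih
    refine ⟨ℓ + 1, Fin.snoc (α := fun _ => V) w x, Fin.snoc (α := fun _ => Fin L) t ⟨b, hb⟩,
      ?_, ?_, ?_, ?_, ?_, ?_⟩
    · intro i j hij
      induction j using Fin.lastCases with
      | last =>
        induction i using Fin.lastCases with
        | last => exact absurd hij (lt_irrefl _)
        | cast i => simpa [Fin.lt_def] using h6 i
      | cast j =>
        induction i using Fin.lastCases with
        | last => exact absurd hij (by simp [Fin.lt_def])
        | cast i => simpa using h1 (by simpa using hij)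
    · have : (0 : Fin (ℓ + 1 + 1)) = Fin.castSucc 0 := rfl
      rw [this, Fin.snoc_castSucc]; exact h2
    · simp
    · intro y hy
      rcases hy with rfl | hy
      · exact ⟨Fin.last _, by simp⟩
      · obtain ⟨i, hi⟩ := h4 y hy
        exact ⟨i.castSucc, by simpa using hi⟩
    · intro i
      induction i using Fin.lastCases with
      | last => simpa [h3] using hadj
      | cast i =>
        rw [Fin.snoc_castSucc, Fin.snoc_castSucc, ← Fin.castSucc_succ, Fin.snoc_castSucc]
        exact h5 i
    · intro i
      induction i using Fin.lastCases with
      | last => simp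
      | cast i => simpa using (h6 i).trans (Nat.lt_succ_self _)

theorem window {Δ : ℕ} (hΔ : DeltaTConnected Δ G) (a : ℕ) (ha : a + Δ ≤ L) (v u : V) :
    ∃ S, J G a v (a + Δ) u S := by
  obtain ⟨ℓ, w, t, h1, h2, h3, h4⟩ := hΔ a ha v u
  have key : ∀ i (hi : i < ℓ + 1), ∀ b, a ≤ b → (∀ m : Fin ℓ, m.val < i → a + (t m).val < b) →
      ∃ S, J G a v b (w ⟨i, hi⟩) S := by
    intro i
    induction i with
    | zero =>
      intro hi b hab _
      refine ⟨{v}, ?_⟩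
      have : w ⟨0, hi⟩ = v := h2
      rw [this]
      exact J.refl.waits hab
    | succ i ih =>
      intro hi b hab hb
      obtain ⟨S, hS⟩ := ih (by omega) (a + (t ⟨i, by omega⟩).val) (by omega) (by
        intro m hm
        have := h1 (show m < ⟨i, by omega⟩ from hm)
        have : (t m).val < (t ⟨i, by omega⟩).val := this
        omega)
      have hlt := (t ⟨i, by omega⟩).isLt
      have hadj := h4 ⟨i, by omega⟩
      exact ⟨_, (hS.step (by omega) hadj).waits (hb ⟨i, by omega⟩ (Nat.lt_succ_self _))⟩
  obtain ⟨S, hS⟩ := key ℓ (Nat.lt_succ_self _) (a + Δ) (by omega) (by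
    intro m _
    have := (t m).isLt
    omega)
  refine ⟨S, ?_⟩
  rw [← h3]
  exact hS

open Classical in
/-- Indicator that tour edge `j` is missing at time `s`. -/
noncomputable def mis (G : Fin L → SimpleGraph V) (w : ℕ → V) (s j : ℕ) : ℕ :=
  if ∃ h : s < L, (G ⟨s, h⟩).Adj (w j) (w (j + 1)) then 0 else 1

theorem segment (w : ℕ → V) (g : ℕ → ℕ) (Ng : ℕ) (hg : ∀ i j, i < j → j < Ng → g i < g j)
    (base c0 a ℓ : ℕ) (hc0 : ∀ i, base ≤ i → i < Ng → c0 ≤ g i) (r : ℕ) (hr : base + r ≤ Ng) :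
    ∃ p ≤ ℓ, ∃ c S, J G c0 (w a) c (w (a + p)) S ∧ (∀ q ≤ p, w (a + q) ∈ S) ∧
      (∀ i, base + r ≤ i → i < Ng → c ≤ g i) ∧
      (p = ℓ ∨ r ≤ p + ∑ r' ∈ Finset.range r, ∑ j ∈ Finset.Ico a (a + ℓ), mis G w (g (base + r')) j) := by
  induction r with
  | zero =>
    refine ⟨0, Nat.zero_le _, c0, _, J.refl, ?_, hc0, Or.inr (Nat.zero_le _)⟩
    intro q hq
    obtain rfl : q = 0 := by omega
    simp
  | succ r ih =>
    obtain ⟨p, hp, c, S, hJ, hS, hc, hpl⟩ := ih (by omega)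
    have hcg : c ≤ g (base + r) := hc _ le_rfl (by omega)
    have hnext : ∀ i, base + (r + 1) ≤ i → i < Ng → g (base + r) + 1 ≤ g i :=
      fun i hi hi' => hg _ _ (by omega) hi'
    by_cases hpe : p = ℓ
    · exact ⟨p, hp, c, S, hJ, hS, fun i hi => hc i (by omega), Or.inl hpe⟩
    have hpl' := hpl.resolve_left hpe
    by_cases hm : ∃ h : g (base + r) < L, (G ⟨g (base + r), h⟩).Adj (w (a + p)) (w (a + p + 1))
    · obtain ⟨h, hadj⟩ := hm
      refine ⟨p + 1, by omega, g (base + r) + 1, _, (hJ.waits hcg).step h hadj, ?_, hnext, ?_⟩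
      · intro q hq
        rcases Nat.lt_or_ge p q with h' | h'
        · obtain rfl : q = p + 1 := by omega
          exact Set.mem_insert _ _
        · exact Set.mem_insert_of_mem _ (hS q h')
      · right
        rw [Finset.sum_range_succ]
        omega
    · refine ⟨p, hp, c, S, hJ, hS, fun i hi => hc i (by omega), Or.inr ?_⟩
      rw [Finset.sum_range_succ]
      have h1 : mis G w (g (base + r)) (a + p) = 1 := by
        unfold mis; rw [if_neg hm]
      have h2 : mis G w (g (base + r)) (a + p) ≤
          ∑ j ∈ Finset.Ico a (a + ℓ), mis G w (g (base + r)) j :=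
        Finset.single_le_sum (f := fun j => mis G w (g (base + r)) j)
          (fun _ _ => Nat.zero_le _) (by simp; omega)
      omega

open Classical in
theorem walk_count {T : SimpleGraph V} {x y : V} (p : T.Walk x y) (e : Sym2 V) :
    ((Finset.range p.length).filter
      (fun j => s(p.getVert j, p.getVert (j + 1)) = e)).card = p.edges.count e := by
  rw [Finset.card_filter]
  induction p with
  | nil => simp
  | @cons u v w h p ih =>
    rw [SimpleGraph.Walk.length_cons, Finset.sum_range_succ', SimpleGraph.Walk.edges_cons,
      List.count_cons, ← ih]
    simp [-Finset.sum_boole]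
    first | rfl | (refine Finset.sum_congr rfl fun i _ => ?_; congr)

open Classical in
theorem tour_aux [Fintype V] {T : SimpleGraph V} (hT : T.Connected) (v : V) (s : ℕ)
    (hs : s + 1 ≤ Fintype.card V) :
    ∃ p : T.Walk v v, p.support.toFinset.card = s + 1 ∧ p.length = 2 * s ∧
      ∀ e, p.edges.count e ≤ 2 := by
  induction s with
  | zero => exact ⟨SimpleGraph.Walk.nil, by simp, by simp, by simp⟩
  | succ s ih =>
    obtain ⟨p, h1, h2, h3⟩ := ih (by omega)
    have hne : ∃ z, z ∉ p.support := by
      by_contra hcon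
      push Not at hcon
      have : p.support.toFinset = Finset.univ := by
        ext z; simp [hcon z]
      rw [this, Finset.card_univ] at h1
      omega
    obtain ⟨z, hz⟩ := hne
    obtain ⟨q⟩ := hT.preconnected v z
    obtain ⟨d, hd, hd1, hd2⟩ := q.exists_boundary_dart {x | x ∈ p.support} (by simp) hz
    have hx : d.fst ∈ p.support := hd1
    have hy : d.snd ∉ p.support := hd2
    have hadj : T.Adj d.fst d.snd := d.adj
    generalize d.fst = x at *
    generalize d.snd = y at *
    refine ⟨(p.takeUntil x hx).append
      (SimpleGraph.Walk.cons hadj (SimpleGraph.Walk.cons hadj.symm (p.dropUntil x hx))), ?_, ?_, ?_⟩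
    · have : ((p.takeUntil x hx).append
          (SimpleGraph.Walk.cons hadj (SimpleGraph.Walk.cons hadj.symm
            (p.dropUntil x hx)))).support.toFinset = insert y p.support.toFinset := by
        ext u
        have hsp : u ∈ p.support ↔ u ∈ (p.takeUntil x hx).support ∨ u ∈ (p.dropUntil x hx).support := by
          rw [← SimpleGraph.Walk.mem_support_append_iff, SimpleGraph.Walk.take_spec]
        have hxt := SimpleGraph.Walk.end_mem_support (p.takeUntil x hx)
        simp only [List.mem_toFinset, SimpleGraph.Walk.mem_support_append_iff,
          SimpleGraph.Walk.support_cons, List.mem_cons, Finset.mem_insert, hsp]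
        constructor
        · rintro (h | rfl | rfl | h) <;> tauto
        · tauto
      rw [this, Finset.card_insert_of_notMem (by simpa using hy), h1]
    · have := congrArg SimpleGraph.Walk.length (p.take_spec hx)
      rw [SimpleGraph.Walk.length_append] at this
      simp only [SimpleGraph.Walk.length_append, SimpleGraph.Walk.length_cons]
      omega
    · intro e
      have h := congrArg (fun q => q.edges.count e) (p.take_spec hx)
      simp only [SimpleGraph.Walk.edges_append, List.count_append] at h
      simp only [SimpleGraph.Walk.edges_append, List.count_append, SimpleGraph.Walk.edges_cons,
        List.count_cons]
      have h3e := h3 e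
      by_cases he : e = s(x, y)
      · have h0 : p.edges.count e = 0 := by
          rw [List.count_eq_zero, he]
          intro hmem
          exact hy (p.snd_mem_support_of_mem_edges hmem)
        split_ifs <;> omega
      · have e1 : (s(x, y) == e) = false := by simpa using fun h => he h.symm
        have e2 : (s(y, x) == e) = false := by
          rw [Sym2.eq_swap]; exact e1
        simp only [e1, e2]
        simp
        omega

open Classical in
theorem tour [Fintype V] {T : SimpleGraph V} (hT : T.Connected) (v : V) :
    ∃ (w : ℕ → V) (M : ℕ), M ≤ 2 * Fintype.card V ∧ (∀ x, ∃ p ≤ M, w p = x) ∧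
      (∀ j < M, T.Adj (w j) (w (j + 1))) ∧
      ∀ e, ((Finset.range M).filter (fun j => s(w j, w (j + 1)) = e)).card ≤ 2 := by
  have hpos : 0 < Fintype.card V := Fintype.card_pos_iff.mpr ⟨v⟩
  obtain ⟨p, h1, h2, h3⟩ := tour_aux hT v (Fintype.card V - 1) (by omega)
  refine ⟨p.getVert, p.length, by omega, ?_, fun j hj => p.adj_getVert_succ hj, ?_⟩
  · intro x
    have : p.support.toFinset = Finset.univ := by
      apply Finset.eq_univ_of_card; omega
    have hx : x ∈ p.support := by
      rw [← List.mem_toFinset, this]; simp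
    obtain ⟨n, hn, hn'⟩ := SimpleGraph.Walk.mem_support_iff_exists_getVert.mp hx
    exact ⟨n, hn', hn⟩
  · intro e
    rw [walk_count]; exact h3 e

open Classical in
theorem mis_sum [Fintype V] {T : SimpleGraph V} (w : ℕ → V) (M k s : ℕ)
    (hadj : ∀ j < M, T.Adj (w j) (w (j + 1)))
    (h2 : ∀ e, ((Finset.range M).filter (fun j => s(w j, w (j + 1)) = e)).card ≤ 2)
    (hs : s < L) (hk : KDeficientWrt T (G ⟨s, hs⟩) k) :
    ∑ j ∈ Finset.range M, mis G w s j ≤ 2 * k := by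
  have e1 : ∑ j ∈ Finset.range M, mis G w s j =
      ((Finset.range M).filter (fun j => ¬ (G ⟨s, hs⟩).Adj (w j) (w (j + 1)))).card := by
    rw [Finset.card_filter]
    apply Finset.sum_congr rfl
    intro j _
    unfold mis
    by_cases h : (G ⟨s, hs⟩).Adj (w j) (w (j + 1))
    · rw [if_pos ⟨hs, h⟩, if_neg (by simpa using h)]
    · rw [if_neg (fun ⟨_, h'⟩ => h h'), if_pos h]
  rw [e1]
  set A := (Finset.range M).filter (fun j => ¬ (G ⟨s, hs⟩).Adj (w j) (w (j + 1))) with hA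
  have h3 : A.card ≤ 2 * (A.image (fun j => s(w j, w (j + 1)))).card := by
    apply Finset.card_le_mul_card_image
    intro e _
    refine le_trans (Finset.card_le_card ?_) (h2 e)
    intro j hj
    simp only [hA, Finset.mem_filter] at hj ⊢
    exact ⟨hj.1.1, hj.2⟩
  have h4 : (A.image (fun j => s(w j, w (j + 1)))).card ≤ k := by
    refine le_trans ?_ hk
    rw [← Set.ncard_coe_finset]
    apply Set.ncard_le_ncard _ (Set.toFinite _)
    intro e he
    simp only [Finset.coe_image, Set.mem_image, Finset.mem_coe, hA, Finset.mem_filter,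
      Finset.mem_range] at he
    obtain ⟨j, ⟨hj, hj'⟩, rfl⟩ := he
    exact ⟨hadj j hj, hj'⟩
  omega

theorem pieces (c : ℕ → ℕ) (M C s : ℕ) :
    ∃ a ℓ, a + ℓ ≤ M ∧ ∑ j ∈ Finset.Ico a (a + ℓ), c j ≤ C ∧
      ∀ p ≤ M, (∑ j ∈ Finset.range p, c j) / (C + 1) = s → a ≤ p ∧ p ≤ a + ℓ := by
  classical
  set A := (Finset.range (M + 1)).filter (fun p => (∑ j ∈ Finset.range p, c j) / (C + 1) = s) with hA
  by_cases hne : A.Nonempty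
  · have h1 := Finset.min'_mem A hne
    have h2 := Finset.max'_mem A hne
    have h12 : A.min' hne ≤ A.max' hne := Finset.min'_le _ _ h2
    have hmin : ∀ p ∈ A, A.min' hne ≤ p := fun p hp => Finset.min'_le _ _ hp
    have hmax : ∀ p ∈ A, p ≤ A.max' hne := fun p hp => Finset.le_max' _ _ hp
    generalize A.min' hne = a at *
    generalize A.max' hne = b at *
    have hb : a + (b - a) = b := by omega
    refine ⟨a, b - a, ?_, ?_, ?_⟩
    · simp only [hA, Finset.mem_filter, Finset.mem_range] at h2
      omega
    · rw [hb]
      have hsum := Finset.sum_range_add_sum_Ico c h12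
      simp only [hA, Finset.mem_filter, Finset.mem_range] at h1 h2
      have d1 := Nat.div_add_mod (∑ j ∈ Finset.range a, c j) (C + 1)
      have d2 := Nat.div_add_mod (∑ j ∈ Finset.range b, c j) (C + 1)
      have m2 := Nat.mod_lt (∑ j ∈ Finset.range b, c j) (Nat.succ_pos C)
      rw [h1.2] at d1
      rw [h2.2] at d2
      simp only [Nat.succ_eq_add_one] at m2
      omega
    · intro p hp hps
      have : p ∈ A := by
        simp only [hA, Finset.mem_filter, Finset.mem_range]; exact ⟨by omega, hps⟩
      rw [hb]
      exact ⟨hmin p this, hmax p this⟩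
  · refine ⟨0, 0, by omega, by simp, ?_⟩
    intro p hp hps
    exact absurd ⟨p, by simp only [hA, Finset.mem_filter, Finset.mem_range]; exact ⟨by omega, hps⟩⟩ hne

/-- Combinatorial core with integer bounds. -/
theorem core [Fintype V] (Δ k t : ℕ) (hk : 1 ≤ k) (hn : Fintype.card V ≤ k * t + k)
    (ht : k * t ≤ Fintype.card V)
    (hΔ : DeltaTConnected Δ G) (hΔ0 : 1 ≤ Δ) (T : SimpleGraph V) (hT : T.Connected)
    (g : ℕ → ℕ) (Ng : ℕ) (hg : ∀ i j, i < j → j < Ng → g i < g j)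
    (hgL : ∀ i < Ng, ∃ h : g i < L, KDeficientWrt T (G ⟨g i, h⟩) k)
    (hNg : 18 * k * (Δ + t) ≤ Ng) (v : V) : CanExploreFrom G v := by
  classical
  obtain ⟨w, M, hM, hsurj, hadj, h2⟩ := tour hT v
  let idx : ℕ → ℕ → ℕ := fun i r => i * (Δ + t) + Δ + r
  have hidx : ∀ i < 18 * k, ∀ r < t, idx i r < Ng := by
    intro i hi r hr
    have : (i + 1) * (Δ + t) ≤ 18 * k * (Δ + t) := Nat.mul_le_mul_right _ hi
    have e : (i + 1) * (Δ + t) = i * (Δ + t) + Δ + t := by ring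
    simp only [idx]; omega
  let c : ℕ → ℕ := fun j => ∑ i ∈ Finset.range (18 * k),
    (1 + ∑ r ∈ Finset.range t, mis G w (g (idx i r)) j)
  let C : ℕ := (t + 1) * (9 * k)
  have htot : ∑ j ∈ Finset.range M, c j ≤ 8 * k * C := by
    have e1 : ∑ j ∈ Finset.range M, c j = ∑ i ∈ Finset.range (18 * k),
        (M + ∑ r ∈ Finset.range t, ∑ j ∈ Finset.range M, mis G w (g (idx i r)) j) := by
      simp only [c]
      rw [Finset.sum_comm]
      apply Finset.sum_congr rfl
      intro i _
      rw [Finset.sum_add_distrib, Finset.sum_comm]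
      simp
    have e2 : ∑ j ∈ Finset.range M, c j ≤ ∑ i ∈ Finset.range (18 * k), (M + t * (2 * k)) := by
      rw [e1]
      apply Finset.sum_le_sum
      intro i hi
      have : ∑ r ∈ Finset.range t, ∑ j ∈ Finset.range M, mis G w (g (idx i r)) j ≤
          ∑ r ∈ Finset.range t, 2 * k := by
        apply Finset.sum_le_sum
        intro r hr
        obtain ⟨h, hd⟩ := hgL _ (hidx i (Finset.mem_range.mp hi) r (Finset.mem_range.mp hr))
        exact mis_sum w M k _ hadj h2 h hd
      simp only [Finset.sum_const, Finset.card_range, smul_eq_mul] at this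
      omega
    simp only [Finset.sum_const, Finset.card_range, smul_eq_mul] at e2
    refine e2.trans ?_
    have : M + t * (2 * k) ≤ 4 * (k * t + k) := by nlinarith
    calc 18 * k * (M + t * (2 * k)) ≤ 18 * k * (4 * (k * t + k)) := Nat.mul_le_mul_left _ this
      _ = 8 * k * C := by simp only [C]; ring
  choose a ℓ haM hcost hcover using pieces c M C
  -- availability
  let avail : Fin (8 * k + 1) → Finset (Fin (18 * k)) := fun s =>
    Finset.univ.filter (fun i => ℓ s + ∑ r ∈ Finset.range t,
      ∑ j ∈ Finset.Ico (a s) (a s + ℓ s), mis G w (g (idx i r)) j ≤ t)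
  have hav : ∀ s, 8 * k + 1 ≤ (avail s).card := by
    intro s
    have hsplit := Finset.card_filter_add_card_filter_not (s := (Finset.univ : Finset (Fin (18 * k))))
      (fun i => ℓ s + ∑ r ∈ Finset.range t,
      ∑ j ∈ Finset.Ico (a s) (a s + ℓ s), mis G w (g (idx i r)) j ≤ t)
    rw [Finset.card_univ, Fintype.card_fin] at hsplit
    set X := Finset.univ.filter (fun i : Fin (18 * k) => ¬ (ℓ s + ∑ r ∈ Finset.range t,
      ∑ j ∈ Finset.Ico (a s) (a s + ℓ s), mis G w (g (idx i r)) j ≤ t)) with hX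
    have hXc : X.card * (t + 1) ≤ C := by
      refine le_trans ?_ (hcost s)
      have e1 : ∑ j ∈ Finset.Ico (a s) (a s + ℓ s), c j = ∑ i : Fin (18 * k), (ℓ s +
          ∑ r ∈ Finset.range t, ∑ j ∈ Finset.Ico (a s) (a s + ℓ s), mis G w (g (idx i r)) j) := by
        simp only [c]
        rw [Finset.sum_comm, Finset.sum_range]
        apply Finset.sum_congr rfl
        intro i _
        rw [Finset.sum_add_distrib, Finset.sum_comm]
        simp
      rw [e1]
      calc X.card * (t + 1) = ∑ i ∈ X, (t + 1) := by simp
        _ ≤ ∑ i ∈ X, (ℓ s + ∑ r ∈ Finset.range t,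
            ∑ j ∈ Finset.Ico (a s) (a s + ℓ s), mis G w (g (idx i r)) j) := by
          apply Finset.sum_le_sum
          intro i hi
          simp only [hX, Finset.mem_filter] at hi
          have := hi.2
          omega
        _ ≤ _ := Finset.sum_le_sum_of_subset (Finset.subset_univ _)
    have hX9 : X.card ≤ 9 * k := by
      have : X.card * (t + 1) ≤ 9 * k * (t + 1) := by
        rw [Nat.mul_comm (9 * k)]; exact hXc
      exact Nat.le_of_mul_le_mul_right this (Nat.succ_pos t)
    change 8 * k + 1 ≤ (Finset.filter _ _).card
    omega
  obtain ⟨φ, hφinj, hφ⟩ := (Finset.all_card_le_biUnion_card_iff_exists_injective avail).mp (by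
    intro A
    rcases A.eq_empty_or_nonempty with rfl | ⟨s, hs⟩
    · simp
    · have h1 : A.card ≤ 8 * k + 1 := by simpa using Finset.card_le_univ A
      exact h1.trans ((hav s).trans (Finset.card_le_card (Finset.subset_biUnion_of_mem avail hs))))
  -- run the phases
  have hgadd : ∀ i d, i + d < Ng → g i + d ≤ g (i + d) := by
    intro i d
    induction d with
    | zero => intro _; exact le_rfl
    | succ d ih =>
      intro h
      have := ih (by omega)
      have := hg (i + d) (i + (d + 1)) (by omega) h
      omega
  have hrun : ∀ i ≤ 18 * k, ∃ b u S, J G 0 v b u S ∧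
      (∀ m, i * (Δ + t) ≤ m → m < Ng → b ≤ g m) ∧
      ∀ s : Fin (8 * k + 1), (φ s).val < i → ∀ q ≤ ℓ s, w (a s + q) ∈ S := by
    intro i
    induction i with
    | zero =>
      intro _
      exact ⟨0, v, _, J.refl, fun _ _ _ => Nat.zero_le _, fun s hs => absurd hs (Nat.not_lt_zero _)⟩
    | succ i ih =>
      intro hi
      obtain ⟨b, u, S, hJ, hb, hS⟩ := ih (by omega)
      have hle : (i + 1) * (Δ + t) ≤ 18 * k * (Δ + t) := Nat.mul_le_mul_right _ hi
      have e : (i + 1) * (Δ + t) = i * (Δ + t) + Δ + t := by ring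
      by_cases hex : ∃ s, (φ s).val = i
      · obtain ⟨s, hs⟩ := hex
        have hst : i * (Δ + t) < Ng := by omega
        have hlast := hgadd (i * (Δ + t)) (Δ - 1) (by omega)
        obtain ⟨hL, _⟩ := hgL (i * (Δ + t) + (Δ - 1)) (by omega)
        obtain ⟨S1, hJ1⟩ := window hΔ (g (i * (Δ + t))) (by omega) u (w (a s))
        obtain ⟨p, hp, c', S2, hJ2, hS2, hc', hor⟩ := segment (G := G) w g Ng hg
          (i * (Δ + t) + Δ) (g (i * (Δ + t)) + Δ) (a s) (ℓ s) (by
            intro m hm hm'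
            have := hgadd (i * (Δ + t)) (m - i * (Δ + t)) (by omega)
            rw [show i * (Δ + t) + (m - i * (Δ + t)) = m by omega] at this
            omega) t (by omega)
        have hpe : p = ℓ s := by
          rcases hor with h | h
          · exact h
          · have := hφ s
            simp only [avail, Finset.mem_filter, idx, hs] at this
            have := this.2
            omega
        refine ⟨c', _, _, ((hJ.waits (hb _ le_rfl hst)).trans hJ1).trans hJ2, ?_, ?_⟩
        · intro m hm; exact hc' m (by omega)
        · intro s' hs' q hq
          rcases Nat.lt_or_ge (φ s').val i with h | h
          · exact Or.inl (Or.inl (hS s' h q hq))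
          · have : s' = s := hφinj (Fin.ext (by omega))
            subst this
            exact Or.inr (hS2 q (by omega))
      · refine ⟨b, u, S, hJ, fun m hm => hb m (by omega), ?_⟩
        intro s hs
        apply hS s
        have : (φ s).val ≠ i := fun h => hex ⟨s, h⟩
        omega
  obtain ⟨b, u, S, hJ, _, hS⟩ := hrun (18 * k) le_rfl
  obtain ⟨len, w', t', h1', h2', _, h4', h5', _⟩ := hJ.explore
  refine ⟨len, w', t', h1', h2', ?_, h5'⟩
  intro x
  apply h4'
  obtain ⟨p, hp, rfl⟩ := hsurj x
  have hlt : (∑ j ∈ Finset.range p, c j) / (C + 1) < 8 * k + 1 := by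
    have h1 : ∑ j ∈ Finset.range p, c j ≤ ∑ j ∈ Finset.range M, c j :=
      Finset.sum_le_sum_of_subset (Finset.range_mono hp)
    rw [Nat.div_lt_iff_lt_mul (Nat.succ_pos C)]
    nlinarith
  obtain ⟨q1, q2⟩ := hcover _ p hp rfl
  have := hS ⟨_, hlt⟩ (φ _).isLt (p - a ((∑ j ∈ Finset.range p, c j) / (C + 1))) (by
    simp only; omega)
  rwa [show a ((∑ j ∈ Finset.range p, c j) / (C + 1)) +
    (p - a ((∑ j ∈ Finset.range p, c j) / (C + 1))) = p by omega] at this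

end KDefAux

/-- **Theorem 1 (paper).** If `𝒢` is a `Δ`-temporally connected temporal graph on `n`
vertices, `T` is a spanning tree of its underlying graph, and `𝒢` contains at least
`⌈18k ln(6k)⌉ (Δ + n/k)` snapshots that are `k`-edge-deficient with respect to `T`,
then `𝒢` can be explored from any vertex. -/
theorem kDef_exploration (Δ k n L : ℕ) (hk : 1 ≤ k)
    (V : Type*) [Fintype V] (hn : Fintype.card V = n)
    (G : Fin L → SimpleGraph V)
    (hΔ : DeltaTConnected Δ G)
    (T : SimpleGraph V) (hT : IsSpanningTree T (⨆ t, G t))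
    (hcount : (⌈(18 * k : ℝ) * Real.log (6 * k)⌉₊ : ℝ) * ((Δ : ℝ) + (n : ℝ) / (k : ℝ))
      ≤ ({t : Fin L | KDeficientWrt T (G t) k}.ncard : ℝ)) :
    ∀ v : V, CanExploreFrom G v := by
  intro v
  classical
  rcases Nat.eq_zero_or_pos Δ with h0 | hpos
  · subst h0
    refine ⟨0, fun _ => v, Fin.elim0, fun i => i.elim0, rfl, ?_, fun i => i.elim0⟩
    intro x
    obtain ⟨S, hS⟩ := KDefAux.window hΔ 0 (Nat.zero_le _) v x
    obtain ⟨ℓ, w, t, -, h1, h2, -, -, h3⟩ := hS.explore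
    rcases Nat.eq_zero_or_pos ℓ with h | h
    · subst h
      exact ⟨0, by rw [← h1, ← h2]; rfl⟩
    · exact absurd (h3 ⟨0, h⟩) (Nat.not_lt_zero _)
  · set A : Finset (Fin L) := Finset.univ.filter (fun t => KDeficientWrt T (G t) k) with hA
    have hcard : {t : Fin L | KDeficientWrt T (G t) k}.ncard = A.card := by
      rw [← Set.ncard_coe_finset]; congr 1; ext t; simp [hA]
    rw [hcard] at hcount
    have hk' : (1 : ℝ) ≤ k := by exact_mod_cast hk
    have hlog : 1 ≤ Real.log (6 * k) := by
      rw [Real.le_log_iff_exp_le (by positivity)]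
      have := Real.exp_one_lt_d9
      linarith
    have hceil : (18 * k : ℝ) ≤ (⌈(18 * k : ℝ) * Real.log (6 * k)⌉₊ : ℝ) := by
      refine le_trans ?_ (Nat.le_ceil _)
      nlinarith
    have hdiv : ((n / k : ℕ) : ℝ) ≤ (n : ℝ) / k := Nat.cast_div_le
    have hNg : 18 * k * (Δ + n / k) ≤ A.card := by
      have : (18 * k : ℝ) * ((Δ : ℝ) + ((n / k : ℕ) : ℝ)) ≤ (A.card : ℝ) := by
        refine le_trans ?_ hcount
        gcongr
      exact_mod_cast this
    let f := A.orderEmbOfFin rfl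
    have hdm := Nat.div_add_mod n k
    have hml := Nat.mod_lt n hk
    refine KDefAux.core Δ k (n / k) hk (by omega) (by omega) hΔ hpos T hT.2.connected
      (fun i => if h : i < A.card then (f ⟨i, h⟩).val else 0) A.card ?_ ?_ hNg v
    · intro i j hij hj
      have hi : i < A.card := hij.trans hj
      simp only [hi, hj, dif_pos]
      have : f ⟨i, hi⟩ < f ⟨j, hj⟩ := f.strictMono hij
      exact this
    · intro i hi
      simp only [hi, dif_pos]
      refine ⟨(f ⟨i, hi⟩).isLt, ?_⟩
      have := A.orderEmbOfFin_mem rfl ⟨i, hi⟩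
      simp only [hA, Finset.mem_filter] at this
      exact this.2
end

section
/- Let Δ, k, and n be natural numbers with k ≥ 1, and let 𝒢 be a Δ-temporally connected, k-edge-deficient temporal graph on n vertices. If the lifetime of 𝒢 is at least 2·⌈36k·ln(12k)⌉·(Δ + n/(2k)), then 𝒢 can be explored from any vertex. (This is the existence part of the paper's Theorem 2; the algorithmic claim about polynomial-time computability is omitted.) -/
namespace KDef

/-- lazy trajectory from time `a` to time `b`, visiting all of `S`. -/
def Trav {V : Type*} (H : ℕ → SimpleGraph V) (a b : ℕ) (v u : V) (S : Set V) : Prop :=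
  ∃ f : ℕ → V, f a = v ∧ f b = u ∧
    (∀ t, a ≤ t → t < b → (f (t+1) = f t ∨ (H t).Adj (f t) (f (t+1)))) ∧
    ∀ x ∈ S, ∃ t, a ≤ t ∧ t ≤ b ∧ f t = x

lemma Trav.trans {V : Type*} {H : ℕ → SimpleGraph V} {a b c : ℕ} {v u x : V} {S S' : Set V}
    (hab : a ≤ b) (hbc : b ≤ c)
    (h1 : Trav H a b v u S) (h2 : Trav H b c u x S') : Trav H a c v x (S ∪ S') := by
  obtain ⟨f, f1, f2, f3, f4⟩ := h1
  obtain ⟨g, g1, g2, g3, g4⟩ := h2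
  have key : ∀ t, b ≤ t → (if t ≤ b then f t else g t) = g t := by
    intro t ht
    split_ifs with h
    · have : t = b := by omega
      subst this; rw [f2, g1]
    · rfl
  refine ⟨fun t => if t ≤ b then f t else g t, ?_, ?_, ?_, ?_⟩
  · simp [hab, f1]
  · exact (key c hbc).trans g2
  · intro t ht1 ht2
    by_cases h : t < b
    · have := f3 t ht1 h
      simpa [show t ≤ b by omega, show t + 1 ≤ b by omega] using this
    · simp only [key t (by omega), key (t+1) (by omega)]
      exact g3 t (by omega) ht2
  · rintro y (hy | hy)
    · obtain ⟨t, h1, h2, h3⟩ := f4 y hy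
      exact ⟨t, h1, by omega, by simp [h2, h3]⟩
    · obtain ⟨t, h1, h2, h3⟩ := g4 y hy
      exact ⟨t, by omega, h2, (key t h1).trans h3⟩

lemma Trav.mono {V : Type*} {H : ℕ → SimpleGraph V} {a b : ℕ} {v u : V} {S S' : Set V}
    (h : Trav H a b v u S) (hS : S' ⊆ S) : Trav H a b v u S' := by
  obtain ⟨f, f1, f2, f3, f4⟩ := h
  exact ⟨f, f1, f2, f3, fun x hx => f4 x (hS hx)⟩

lemma Trav.stay {V : Type*} (H : ℕ → SimpleGraph V) (a b : ℕ) (hab : a ≤ b) (v : V) :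
    Trav H a b v v {v} :=
  ⟨fun _ => v, rfl, rfl, fun _ _ _ => Or.inl rfl, fun x hx => ⟨a, le_rfl, hab, hx.symm⟩⟩

lemma Trav.edge {V : Type*} (H : ℕ → SimpleGraph V) (a : ℕ) (v u : V) (h : (H a).Adj v u) :
    Trav H a (a+1) v u {u} := by
  refine ⟨fun t => if t ≤ a then v else u, by simp, by simp, ?_, ?_⟩
  · intro t h1 h2
    have : t = a := by omega
    subst this
    right; simpa using h
  · intro x hx
    exact ⟨a+1, by omega, by omega, by simpa using hx.symm⟩

lemma trav_of_seq {V : Type*} (H : ℕ → SimpleGraph V) (a : ℕ) (w : ℕ → V) (t : ℕ → ℕ) (m : ℕ) :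
    (∀ i j, i < j → j < m → t i < t j) → (∀ i, i < m → a ≤ t i) →
    (∀ i, i < m → (H (t i)).Adj (w i) (w (i+1))) →
    ∀ b, a ≤ b → (∀ i, i < m → t i < b) → Trav H a b (w 0) (w m) ∅ := by
  induction m with
  | zero =>
    intro _ _ _ b hab _
    exact (Trav.stay H a b hab _).mono (by simp)
  | succ m ih =>
    intro h1 h2 h3 b hab h4
    have A := ih (fun i j hij hj => h1 i j hij (by omega)) (fun i hi => h2 i (by omega))
      (fun i hi => h3 i (by omega)) (t m) (h2 m (by omega)) (fun i hi => h1 i m hi (by omega))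
    have hm := h2 m (by omega)
    have hb := h4 m (by omega)
    have B := Trav.edge H (t m) _ _ (h3 m (by omega))
    have C := Trav.stay H (t m + 1) b (by omega) (w (m+1))
    exact ((A.trans hm (by omega) B).trans (by omega) (by omega) C).mono (by simp)

/-- extension of the snapshots to all natural times -/
noncomputable def ext {V : Type*} {L : ℕ} (G : Fin L → SimpleGraph V) : ℕ → SimpleGraph V :=
  fun t => if h : t < L then G ⟨t, h⟩ else ⊥

lemma trav_of_delta {V : Type*} {L Δ : ℕ} (G : Fin L → SimpleGraph V)
    (hΔ : DeltaTConnected Δ G) (a : ℕ) (ha : a + Δ ≤ L) (v u : V) :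
    Trav (ext G) a (a + Δ) v u ∅ := by
  obtain ⟨ℓ, w, t, ht, h0, hl, hadj⟩ := hΔ a ha v u
  have := trav_of_seq (ext G) a (fun i => if h : i < ℓ + 1 then w ⟨i, h⟩ else v)
    (fun i => if h : i < ℓ then a + (t ⟨i, h⟩).val else 0) ℓ ?_ ?_ ?_ (a + Δ) (by omega) ?_
  · have e1 : (⟨0, by omega⟩ : Fin (ℓ+1)) = 0 := rfl
    have e2 : (⟨ℓ, by omega⟩ : Fin (ℓ+1)) = Fin.last ℓ := rfl
    simpa [e1, e2, h0, hl] using this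
  · intro i j hij hj
    have hi : i < ℓ := by omega
    simp only [hi, hj, dif_pos]
    have : t ⟨i, hi⟩ < t ⟨j, hj⟩ := ht (by simpa using hij)
    have := Fin.lt_def.1 this
    omega
  · intro i hi
    simp [hi]
  · intro i hi
    have := hadj ⟨i, hi⟩
    have hlt := (t ⟨i, hi⟩).isLt
    have h2 : a + (t ⟨i, hi⟩).val < L := by omega
    simp only [hi, dif_pos, ext, h2, show i < ℓ + 1 by omega, show i + 1 < ℓ + 1 by omega]
    exact this
  · intro i hi
    simp [hi]

lemma seq_of_traj {V : Type*} (H : ℕ → SimpleGraph V) (f : ℕ → V) (b : ℕ) :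
    (∀ t, t < b → (f (t+1) = f t ∨ (H t).Adj (f t) (f (t+1)))) →
    ∃ (ℓ : ℕ) (w : ℕ → V) (t : ℕ → ℕ), (∀ i j, i < j → j < ℓ → t i < t j) ∧
      (∀ i, i < ℓ → t i < b) ∧ w 0 = f 0 ∧ w ℓ = f b ∧
      (∀ i, i < ℓ → (H (t i)).Adj (w i) (w (i+1))) ∧
      ∀ s, s ≤ b → ∃ i, i ≤ ℓ ∧ w i = f s := by
  induction b with
  | zero =>
    intro _
    refine ⟨0, f, id, by omega, by omega, rfl, rfl, by omega, ?_⟩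
    intro s hs; exact ⟨0, le_rfl, by rw [show s = 0 by omega]⟩
  | succ b ih =>
    intro h
    obtain ⟨ℓ, w, t, h1, h2, h3, h4, h5, h6⟩ := ih (fun t ht => h t (by omega))
    rcases h b (by omega) with hb | hb
    · refine ⟨ℓ, w, t, h1, fun i hi => by have := h2 i hi; omega, h3, by rw [h4, hb], h5, ?_⟩
      intro s hs
      rcases Nat.lt_or_ge b s with h' | h'
      · have : s = b + 1 := by omega
        subst this
        exact ⟨ℓ, le_rfl, by rw [h4, hb]⟩
      · exact h6 s h'
    · refine ⟨ℓ+1, fun i => if i ≤ ℓ then w i else f (b+1), fun i => if i < ℓ then t i else b,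
        ?_, ?_, by simp [h3], by simp, ?_, ?_⟩
      · intro i j hij hj
        have hi : i < ℓ := by omega
        simp only [hi, if_true]
        split_ifs with hj'
        · exact h1 i j hij hj'
        · exact h2 i hi
      · intro i hi
        dsimp only
        split_ifs with hi'
        · have := h2 i hi'; omega
        · omega
      · intro i hi
        by_cases hi' : i < ℓ
        · simpa [hi', show i ≤ ℓ by omega, show i + 1 ≤ ℓ by omega] using h5 i hi'
        · have : i = ℓ := by omega
          subst this
          simpa [h4] using hb
      · intro s hs
        rcases Nat.lt_or_ge b s with h' | h'
        · have : s = b + 1 := by omega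
          subst this
          exact ⟨ℓ+1, le_rfl, by simp⟩
        · obtain ⟨i, hi, hi'⟩ := h6 s h'
          exact ⟨i, by omega, by simp [hi, hi']⟩

lemma explore_of_trav {V : Type*} {L : ℕ} (G : Fin L → SimpleGraph V) (b : ℕ) (hb : b ≤ L)
    (v u : V) (h : Trav (ext G) 0 b v u Set.univ) : CanExploreFrom G v := by
  obtain ⟨f, f1, f2, f3, f4⟩ := h
  obtain ⟨ℓ, w, t, h1, h2, h3, h4, h5, h6⟩ :=
    seq_of_traj (ext G) f b (fun t ht => f3 t (by omega) ht)
  refine ⟨ℓ, fun i => w i.val, fun i => ⟨t i.val, by have := h2 i.val i.isLt; omega⟩, ?_, ?_, ?_, ?_⟩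
  · intro i j hij
    exact h1 i j hij j.isLt
  · simp [h3, f1]
  · intro x
    obtain ⟨s, _, hs, rfl⟩ := f4 x trivial
    obtain ⟨i, hi, hi'⟩ := h6 s hs
    exact ⟨⟨i, by omega⟩, hi'⟩
  · intro i
    have := h5 i i.isLt
    have h' : t i.val < L := by have := h2 i.val i.isLt; omega
    simpa [ext, h'] using this

/-! ### Tour -/

open Classical in
lemma count_edges {V : Type*} {T : SimpleGraph V} {a b : V} (p : T.Walk a b) (e : Sym2 V) :
    ((Finset.range p.length).filter (fun j => s(p.getVert j, p.getVert (j+1)) = e)).card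
      = p.edges.count e := by
  induction p with
  | nil => rfl
  | cons h p ih =>
    rw [Finset.card_filter] at ih ⊢
    rw [SimpleGraph.Walk.length_cons, Finset.sum_range_succ', SimpleGraph.Walk.edges_cons,
      List.count_cons, ← ih]
    simp only [SimpleGraph.Walk.getVert_cons_succ, SimpleGraph.Walk.getVert_zero, beq_iff_eq, zero_add]
    congr!

open Classical in
lemma tour_step {V : Type*} {T : SimpleGraph V} [Fintype V] (hT : T.Connected) (v : V) (m : ℕ)
    (hm : m + 1 ≤ Fintype.card V) :
    ∃ p : T.Walk v v, p.length = 2 * m ∧ p.support.toFinset.card = m + 1 ∧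
      ∀ e, p.edges.count e ≤ 2 := by
  induction m with
  | zero => exact ⟨.nil, by simp, by simp, by simp⟩
  | succ m ih =>
    obtain ⟨p, h1, h2, h3⟩ := ih (by omega)
    have : ∃ y, y ∉ p.support := by
      by_contra hcon
      push Not at hcon
      have : p.support.toFinset = Finset.univ := by ext; simp [hcon]
      rw [this, Finset.card_univ] at h2
      omega
    obtain ⟨y, hy⟩ := this
    obtain ⟨q⟩ := hT.preconnected v y
    obtain ⟨d, hd, hd1, hd2⟩ := q.exists_boundary_dart {x | x ∈ p.support} (by simp) (by simpa using hy)
    simp only [Set.mem_setOf_eq] at hd1 hd2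
    have hadj := d.adj
    generalize d.fst = a at *
    generalize d.snd = b at *
    refine ⟨(p.takeUntil a hd1).append (.cons hadj (.cons hadj.symm (p.dropUntil a hd1))), ?_, ?_, ?_⟩
    · have := congrArg SimpleGraph.Walk.length (p.take_spec hd1)
      simp only [SimpleGraph.Walk.length_append, SimpleGraph.Walk.length_cons] at this ⊢
      omega
    · have : ((p.takeUntil a hd1).append (.cons hadj (.cons hadj.symm (p.dropUntil a hd1)))).support.toFinset
        = insert b p.support.toFinset := by
        ext x
        have : x ∈ p.support ↔ x ∈ ((p.takeUntil a hd1).append (p.dropUntil a hd1)).support := by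
          rw [p.take_spec hd1]
        have ha : a ∈ (p.takeUntil a hd1).support := by simp
        simp only [List.mem_toFinset, Finset.mem_insert, this, SimpleGraph.Walk.mem_support_append_iff,
          SimpleGraph.Walk.support_cons, List.mem_cons]
        constructor
        · rintro (h | rfl | rfl | h) <;> simp_all
        · rintro (h | h | h) <;> simp_all
      rw [this, Finset.card_insert_of_notMem (by simpa using hd2), h2]
    · intro e
      have := congrArg (fun p => p.edges.count e) (p.take_spec hd1)
      have h3e := h3 e
      simp only [SimpleGraph.Walk.edges_append, List.count_append, SimpleGraph.Walk.edges_cons,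
        List.count_cons] at this ⊢
      by_cases he : s(a, b) = e
      · have : p.edges.count e = 0 := by
          rw [List.count_eq_zero, ← he]
          intro hmem
          exact hd2 (p.snd_mem_support_of_mem_edges hmem)
        have e2 : s(b, a) = e := by rw [Sym2.eq_swap]; exact he
        simp [he, e2]; omega
      · have e2 : s(b, a) ≠ e := by rw [Sym2.eq_swap]; exact he
        simp [he, e2]; omega

open Classical in
lemma exists_tour {V : Type*} {T : SimpleGraph V} [Fintype V] (hT : T.Connected) (v : V) :
    ∃ (N : ℕ) (w : ℕ → V), N + 2 = 2 * Fintype.card V ∧ (∀ j, j < N → T.Adj (w j) (w (j+1))) ∧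
      (∀ x, ∃ j, j ≤ N ∧ w j = x) ∧
      ∀ e, ((Finset.range N).filter (fun j => s(w j, w (j+1)) = e)).card ≤ 2 := by
  have hpos : 0 < Fintype.card V := Fintype.card_pos_iff.2 ⟨v⟩
  obtain ⟨p, h1, h2, h3⟩ := tour_step hT v (Fintype.card V - 1) (by omega)
  refine ⟨p.length, p.getVert, by omega, fun j hj => p.adj_getVert_succ hj, ?_, ?_⟩
  · intro x
    have hu : p.support.toFinset = Finset.univ := by
      apply Finset.eq_univ_of_card; omega
    have hx : x ∈ p.support := by
      rw [← List.mem_toFinset, hu]; simp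
    obtain ⟨j, hj, hj'⟩ := SimpleGraph.Walk.mem_support_iff_exists_getVert.1 hx
    exact ⟨j, hj', hj⟩
  · intro e
    rw [count_edges]; exact h3 e

/-! ### Runner -/

open Classical in
/-- position after `i` steps, starting at `p`; `ok i j` says tour edge `j` is available at step `i` -/
noncomputable def run (ok : ℕ → ℕ → Prop) (N p : ℕ) : ℕ → ℕ
  | 0 => p
  | i+1 => if run ok N p i < N ∧ ok i (run ok N p i) then run ok N p i + 1 else run ok N p i

lemma run_mono (ok : ℕ → ℕ → Prop) (N p : ℕ) : Monotone (run ok N p) := by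
  apply monotone_nat_of_le_succ
  intro i
  rw [run]; split_ifs <;> omega

lemma run_le (ok : ℕ → ℕ → Prop) (N p : ℕ) (hp : p ≤ N) (i : ℕ) : run ok N p i ≤ N := by
  induction i with
  | zero => exact hp
  | succ i ih => rw [run]; split_ifs <;> omega

lemma trav_run {V : Type*} (H : ℕ → SimpleGraph V) (w : ℕ → V) (N τ p s : ℕ) :
    Trav H τ (τ + s) (w p)
      (w (run (fun i j => (H (τ + i)).Adj (w j) (w (j+1))) N p s))
      {x | ∃ j, p ≤ j ∧ j ≤ run (fun i j => (H (τ + i)).Adj (w j) (w (j+1))) N p s ∧ w j = x} := by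
  set ok : ℕ → ℕ → Prop := fun i j => (H (τ + i)).Adj (w j) (w (j+1)) with hok
  induction s with
  | zero =>
    refine (Trav.stay H τ τ le_rfl (w p)).mono ?_
    rintro x ⟨j, h1, h2, rfl⟩
    simp only [run] at h2
    rw [show j = p by omega]; rfl
  | succ s ih =>
    rw [run]
    split_ifs with h
    · have := ih.trans (by omega) (by omega) (Trav.edge H (τ + s) _ _ h.2)
      refine this.mono ?_
      rintro x ⟨j, h1, h2, rfl⟩
      rcases Nat.lt_or_ge (run ok N p s) j with h' | h'
      · right
        rw [show j = run ok N p s + 1 by omega]; rfl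
      · left; exact ⟨j, h1, h', rfl⟩
    · exact (ih.trans (by omega) (by omega) (Trav.stay H (τ + s) (τ+(s+1)) (by omega) _)).mono
        (Set.subset_union_left)

open Classical in
/-- number of failures of tour edge `j` during the first `s` steps -/
noncomputable def bl (ok : ℕ → ℕ → Prop) (s j : ℕ) : ℕ :=
  ((Finset.range s).filter (fun i => ¬ ok i j)).card

open Classical in
lemma run_cost (ok : ℕ → ℕ → Prop) (N p s : ℕ) (h : run ok N p s < N) :
    s + p ≤ run ok N p s + ∑ j ∈ Finset.Ico p (run ok N p s + 1), bl ok s j := by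
  induction s with
  | zero => simp [run]
  | succ s ih =>
    have hle : run ok N p s ≤ run ok N p (s+1) := run_mono ok N p (by omega)
    have ih := ih (by omega)
    have hbl : ∀ j, bl ok s j ≤ bl ok (s+1) j := by
      intro j
      apply Finset.card_le_card
      apply Finset.filter_subset_filter
      simp
    have hp : p ≤ run ok N p s := run_mono ok N p (Nat.zero_le s)
    by_cases hc : ok s (run ok N p s)
    · have e : run ok N p (s+1) = run ok N p s + 1 := by
        rw [run, if_pos ⟨by omega, hc⟩]
      rw [e]
      have : ∑ j ∈ Finset.Ico p (run ok N p s + 1), bl ok s j ≤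
          ∑ j ∈ Finset.Ico p (run ok N p s + 1 + 1), bl ok (s+1) j := by
        refine (Finset.sum_le_sum (fun j _ => hbl j)).trans ?_
        apply Finset.sum_le_sum_of_subset
        apply Finset.Ico_subset_Ico_right; omega
      omega
    · have e : run ok N p (s+1) = run ok N p s := by
        rw [run, if_neg (by tauto)]
      rw [e]
      have : ∑ j ∈ Finset.Ico p (run ok N p s + 1), bl ok s j + 1 ≤
          ∑ j ∈ Finset.Ico p (run ok N p s + 1), bl ok (s+1) j := by
        apply Nat.succ_le_of_lt
        apply Finset.sum_lt_sum (fun j _ => hbl j)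
        refine ⟨run ok N p s, by simp [hp], ?_⟩
        unfold bl
        classical
        rw [Finset.range_add_one, Finset.filter_insert, if_pos hc,
          Finset.card_insert_of_notMem (by simp)]
        omega
      omega

/-- start of the `i`-th interval -/
noncomputable def st (ok : ℕ → ℕ → Prop) (N s : ℕ) : ℕ → ℕ
  | 0 => 0
  | i+1 => run ok N (st ok N s i) s + 1

lemma st_lt (ok : ℕ → ℕ → Prop) (N s i : ℕ) : st ok N s i < st ok N s (i+1) := by
  rw [st]
  have := run_mono ok N (st ok N s i) (Nat.zero_le s)
  rw [run] at this
  omega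

lemma st_cost (ok : ℕ → ℕ → Prop) (N s i : ℕ) (h : st ok N s i ≤ N) :
    i * (s+1) ≤ st ok N s i + ∑ j ∈ Finset.range (st ok N s i), bl ok s j := by
  induction i with
  | zero => simp
  | succ i ih =>
    have hlt := st_lt ok N s i
    have ih := ih (by omega)
    have hr : run ok N (st ok N s i) s < N := by rw [st] at h; omega
    have hc := run_cost ok N _ s hr
    have := Finset.sum_range_add_sum_Ico (bl ok s) hlt.le
    rw [← this, add_mul]
    rw [st] at *
    omega

open Classical in
lemma st_end (ok : ℕ → ℕ → Prop) (N s k : ℕ) (hN : N < 4 * k * (s+1)) 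
    (hb : ∀ i, i < s → ((Finset.range N).filter (fun j => ¬ ok i j)).card ≤ 2 * k) :
    N < st ok N s (6 * k) := by
  by_contra h
  push Not at h
  have h1 := st_cost ok N s _ h
  have h2 : ∑ j ∈ Finset.range (st ok N s (6*k)), bl ok s j ≤ ∑ j ∈ Finset.range N, bl ok s j := by
    apply Finset.sum_le_sum_of_subset
    simpa using h
  have h3 : ∑ j ∈ Finset.range N, bl ok s j ≤ s * (2 * k) := by
    unfold bl
    simp only [Finset.card_filter]
    rw [Finset.sum_comm]
    simp only [← Finset.card_filter]
    have := Finset.sum_le_card_nsmul (Finset.range s) 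
      (fun i => ((Finset.range N).filter (fun j => ¬ ok i j)).card) (2*k)
      (fun i hi => hb i (by simpa using hi))
    simpa using this
  nlinarith

/-! ### Covering -/

open Classical in
lemma greedy {K : ℕ} (hK : 0 < K) (A : Finset ℕ) (f : ℕ → ℕ → Fin K) (P : ℕ) :
    ∃ c : ℕ → Fin K, (A.filter (fun x => ∀ φ, φ < P → f φ x ≠ c φ)).card * K ^ P
      ≤ A.card * (K - 1) ^ P := by
  induction P with
  | zero => exact ⟨fun _ => ⟨0, hK⟩, by simp⟩
  | succ P ih =>
    obtain ⟨c, hc⟩ := ih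
    set U := A.filter (fun x => ∀ φ, φ < P → f φ x ≠ c φ) with hU
    have : ∃ i : Fin K, U.card ≤ (U.filter (fun x => f P x = i)).card * K := by
      by_contra hcon
      push Not at hcon
      have h1 := Finset.card_eq_sum_card_fiberwise (s := U) (t := Finset.univ) (f := f P) (by simp)
      have h2 : ∑ i : Fin K, (U.filter (fun x => f P x = i)).card * K < ∑ i : Fin K, U.card := by
        apply Finset.sum_lt_sum_of_nonempty
        · exact ⟨⟨0, hK⟩, by simp⟩
        · intro i _; exact hcon i
      rw [← Finset.sum_mul, ← h1] at h2
      simp [mul_comm] at h2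
    obtain ⟨i, hi⟩ := this
    refine ⟨fun φ => if φ < P then c φ else i, ?_⟩
    have hsub : A.filter (fun x => ∀ φ, φ < P + 1 → f φ x ≠ (if φ < P then c φ else i)) 
        = U.filter (fun x => ¬ f P x = i) := by
      ext x
      simp only [hU, Finset.mem_filter]
      constructor
      · rintro ⟨h1, h2⟩
        refine ⟨⟨h1, fun φ hφ => ?_⟩, ?_⟩
        · simpa [hφ] using h2 φ (by omega)
        · simpa using h2 P (by omega)
      · rintro ⟨⟨h1, h2⟩, h3⟩
        refine ⟨h1, fun φ hφ => ?_⟩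
        split_ifs with h
        · exact h2 φ h
        · rw [show φ = P by omega]; exact h3
    rw [hsub]
    have hs := Finset.card_filter_add_card_filter_not (s := U) (fun x => f P x = i)
    obtain ⟨K', rfl⟩ : ∃ K', K = K' + 1 := ⟨K - 1, by omega⟩
    simp only [Nat.add_sub_cancel] at *
    set X := (U.filter (fun x => ¬ f P x = i)).card
    have h4 : X * (K'+1) ≤ U.card * K' := by nlinarith
    calc X * (K'+1)^(P+1) = (X * (K'+1)) * (K'+1)^P := by ring
      _ ≤ (U.card * K') * (K'+1)^P := by gcongr
      _ = (U.card * (K'+1)^P) * K' := by ring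
      _ ≤ (A.card * K'^P) * K' := by gcongr
      _ = _ := by ring

open Classical in
lemma cover (K N P : ℕ) (hK : 0 < K) (hP : 0 < P) (p : ℕ → ℕ → ℕ) (h0 : ∀ φ, φ < P → p φ 0 = 0)
    (hend : ∀ φ, φ < P → N < p φ K) (hnum : P * K * (K-1)^P < K^P) :
    ∃ c : ℕ → ℕ, ∀ x, x ≤ N → ∃ φ, φ < P ∧ p φ (c φ) ≤ x ∧ x < p φ (c φ + 1) := by
  have hcl : ∀ φ x, ∃ i : Fin K, φ < P → x ≤ N → p φ i ≤ x ∧ x < p φ (i+1) := by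
    intro φ x
    by_cases h : φ < P ∧ x ≤ N
    · have hex : ∃ i, x < p φ i := ⟨K, by have := hend φ h.1; omega⟩
      have hs := Nat.find_spec hex
      have hm := fun m => Nat.find_min (H := hex) (m := m)
      have hle : Nat.find hex ≤ K := Nat.find_min' hex (by have := hend φ h.1; omega)
      generalize Nat.find hex = i at *
      have hi : i ≠ 0 := by
        rintro rfl
        rw [h0 φ h.1] at hs; omega
      obtain ⟨j, rfl⟩ := Nat.exists_eq_succ_of_ne_zero hi
      refine ⟨⟨j, by omega⟩, fun _ _ => ⟨?_, hs⟩⟩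
      have := hm j (by omega)
      simpa using this
    · exact ⟨⟨0, hK⟩, fun a b => absurd ⟨a, b⟩ h⟩
  choose f hf using hcl
  set A : Finset ℕ := ((Finset.range P ×ˢ Finset.range K).image (fun q => p q.1 q.2)) with hA
  have hAc : A.card ≤ P * K := by
    refine Finset.card_image_le.trans ?_
    simp
  obtain ⟨c, hc⟩ := greedy hK A f P
  have hemp : A.filter (fun x => ∀ φ, φ < P → f φ x ≠ c φ) = ∅ := by
    rw [← Finset.card_eq_zero]
    by_contra hne
    have : 1 * K^P ≤ (A.filter (fun x => ∀ φ, φ < P → f φ x ≠ c φ)).card * K^P := by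
      gcongr; omega
    have h2 : A.card * (K-1)^P ≤ P * K * (K-1)^P := by gcongr
    omega
  refine ⟨fun φ => c φ, fun x hx => ?_⟩
  -- largest breakpoint below x
  have hne : (A.filter (fun y => y ≤ x)).Nonempty := by
    refine ⟨0, ?_⟩
    simp only [hA, Finset.mem_filter, Finset.mem_image, Finset.mem_product, Finset.mem_range]
    exact ⟨⟨(0, 0), ⟨hP, hK⟩, h0 0 hP⟩, by omega⟩
  obtain ⟨y, hy, hmax⟩ := Finset.exists_max_image _ id hne
  simp only [Finset.mem_filter, id] at hy hmax
  have : y ∉ A.filter (fun x => ∀ φ, φ < P → f φ x ≠ c φ) := by rw [hemp]; simp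
  simp only [Finset.mem_filter, not_and, not_forall, not_not] at this
  obtain ⟨φ, hφ, hfc⟩ := this hy.1
  obtain ⟨h1, h2⟩ := hf φ y hφ (by omega)
  rw [hfc] at h1 h2
  refine ⟨φ, hφ, h1.trans hy.2, ?_⟩
  show x < p φ (c φ + 1)
  by_contra hcon
  push Not at hcon
  by_cases hlast : (c φ).val + 1 < K
  · have := hmax (p φ (c φ + 1)) ⟨by
      simp only [hA, Finset.mem_image, Finset.mem_product, Finset.mem_range]
      exact ⟨(φ, c φ + 1), ⟨hφ, hlast⟩, rfl⟩, hcon⟩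
    omega
  · have e : (c φ).val + 1 = K := by have := (c φ).isLt; omega
    rw [e] at hcon
    have := hend φ hφ
    omega

/-! ### Numbers -/

lemma numeric (k : ℕ) (hk : 1 ≤ k) (P : ℕ)
    (hP : P = 2 * ⌈(36 * k : ℝ) * Real.log (12 * k)⌉₊) :
    0 < P ∧ P * (6 * k) * (6 * k - 1) ^ P < (6 * k) ^ P := by
  have hk' : (1:ℝ) ≤ k := by exact_mod_cast hk
  have hlog : 0 < Real.log (12 * k) := Real.log_pos (by linarith)
  have hPr : (72 * k : ℝ) * Real.log (12 * k) ≤ P := by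
    have := Nat.le_ceil ((36 * k : ℝ) * Real.log (12 * k))
    rw [hP]; push_cast; linarith
  have hpos : (0:ℝ) < P := lt_of_lt_of_le (by positivity) hPr
  refine ⟨by exact_mod_cast hpos, ?_⟩
  have hK : (0:ℝ) < 6 * k := by positivity
  set y : ℝ := P / (6 * k) with hy
  have hyl : 12 * Real.log (12 * k) ≤ y := by
    rw [hy, le_div_iff₀ hK]; linarith
  have hPy : (P:ℝ) = 6 * k * y := by rw [hy]; field_simp
  have h1 : (1 - 1 / (6 * k : ℝ)) ^ P ≤ Real.exp (-y) := by
    have : 1 - 1 / (6 * k : ℝ) ≤ Real.exp (-(1/(6*k))) := by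
      have := Real.add_one_le_exp (-(1/(6*k:ℝ))); linarith
    have hnn : 0 ≤ 1 - 1 / (6 * k : ℝ) := by
      rw [sub_nonneg, div_le_one hK]; linarith
    calc _ ≤ Real.exp (-(1/(6*k:ℝ))) ^ P := by gcongr
      _ = _ := by rw [← Real.exp_nat_mul, hy]; congr 1; ring
  have h2 : y ≤ 2 * Real.exp (y / 2) := by
    have := Real.add_one_le_exp (y/2); linarith
  have h3 : ((12 * k : ℝ)) ^ 6 ≤ Real.exp (y / 2) := by
    have e : ((12 * k : ℝ)) ^ 6 = Real.exp (6 * Real.log (12 * k)) := by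
      rw [show (6:ℝ) = ((6:ℕ):ℝ) by norm_num, Real.exp_nat_mul, Real.exp_log (by positivity)]
    rw [e]; apply Real.exp_le_exp.2; linarith
  have h4 : 2 * (6 * k : ℝ)^2 < (12 * k)^6 := by
    have a : (1:ℝ) ≤ (12 * k)^4 := one_le_pow₀ (by linarith)
    have b : 2 * (6 * k : ℝ)^2 < (12*k)^2 := by nlinarith
    calc 2 * (6 * k : ℝ)^2 < (12*k : ℝ)^2 * 1 := by linarith
      _ ≤ (12*k : ℝ)^2 * (12 * k : ℝ)^4 := by gcongr
      _ = _ := by ring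
  have h5 : (P:ℝ) * (6 * k) < Real.exp y := by
    have e : Real.exp y = Real.exp (y/2) * Real.exp (y/2) := by rw [← Real.exp_add]; congr 1; ring
    rw [e, hPy]
    have ep := Real.exp_pos (y/2)
    calc 6 * k * y * (6 * k) = (6*k)^2 * y := by ring
      _ ≤ (6*k)^2 * (2 * Real.exp (y/2)) := by gcongr
      _ = (2 * (6*k)^2) * Real.exp (y/2) := by ring
      _ < Real.exp (y/2) * Real.exp (y/2) := by
        apply mul_lt_mul_of_pos_right _ ep; linarith
  have h6 : (P:ℝ) * (6 * k) * (1 - 1 / (6 * k : ℝ)) ^ P < 1 := by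
    calc _ ≤ (P:ℝ) * (6 * k) * Real.exp (-y) := by gcongr
      _ < Real.exp y * Real.exp (-y) := by
        apply mul_lt_mul_of_pos_right h5 (Real.exp_pos _)
      _ = 1 := by rw [← Real.exp_add]; simp
  have h7 : ((P * (6 * k) * (6 * k - 1) ^ P : ℕ) : ℝ) < ((6 * k) ^ P : ℕ) := by
    push_cast [Nat.cast_sub (show 1 ≤ 6 * k by omega)]
    have e : (6 * (k:ℝ) - 1) = (6 * k) * (1 - 1 / (6*k)) := by field_simp
    rw [e, mul_pow]
    have : (0:ℝ) < (6 * k)^P := by positivity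
    calc _ = (6 * (k:ℝ))^P * ((P:ℝ) * (6 * k) * (1 - 1 / (6 * k : ℝ)) ^ P) := by ring
      _ < (6 * (k:ℝ))^P * 1 := by apply mul_lt_mul_of_pos_left h6 this
      _ = _ := by ring
  exact_mod_cast h7

open Classical in
lemma blocked_card {V : Type*} [Fintype V] {T H : SimpleGraph V} {k N : ℕ} {w : ℕ → V}
    (hT : ∀ j, j < N → T.Adj (w j) (w (j+1)))
    (h2 : ∀ e, ((Finset.range N).filter (fun j => s(w j, w (j+1)) = e)).card ≤ 2)
    (hd : KDeficientWrt T H k) :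
    ((Finset.range N).filter (fun j => ¬ H.Adj (w j) (w (j+1)))).card ≤ 2 * k := by
  unfold KDeficientWrt at hd
  have hfin : (T.edgeSet \ H.edgeSet).Finite := Set.toFinite _
  rw [Set.ncard_eq_toFinset_card _ hfin] at hd
  have := Finset.card_le_mul_card_image_of_maps_to
    (s := (Finset.range N).filter (fun j => ¬ H.Adj (w j) (w (j+1))))
    (t := hfin.toFinset) (f := fun j => s(w j, w (j+1))) ?_ 2 ?_
  · omega
  · intro j hj
    simp only [Finset.mem_filter, Finset.mem_range, Finset.mem_coe] at hj
    simp [hT j hj.1, hj.2]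
  · intro e _
    refine le_trans (Finset.card_le_card ?_) (h2 e)
    intro j hj
    simp only [Finset.mem_filter] at hj ⊢
    exact ⟨hj.1.1, hj.2⟩

end KDef

/-- **Theorem 2 (paper), existence part.** If `𝒢` is a `Δ`-temporally connected
`k`-edge-deficient temporal graph on `n` vertices whose lifetime is at least
`2⌈36k ln(12k)⌉ (Δ + n/(2k))`, then `𝒢` can be explored from any vertex. -/
theorem kDef_exploration_lifetime (Δ k n L : ℕ) (hk : 1 ≤ k)
    (V : Type*) [Fintype V] (hn : Fintype.card V = n)
    (G : Fin L → SimpleGraph V)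
    (hΔ : DeltaTConnected Δ G)
    (hdef : ∃ T : SimpleGraph V, IsSpanningTree T (⨆ t, G t) ∧
      ∀ t : Fin L, KDeficientWrt T (G t) k)
    (hL : 2 * (⌈(36 * k : ℝ) * Real.log (12 * k)⌉₊ : ℝ) * ((Δ : ℝ) + (n : ℝ) / (2 * k : ℝ))
      ≤ (L : ℝ)) :
    ∀ v : V, CanExploreFrom G v := by
  classical
  intro v
  obtain ⟨T, ⟨_, hT⟩, hd⟩ := hdef
  obtain ⟨N, w, hN, hw, hsurj, hcnt⟩ := KDef.exists_tour hT.connected v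
  obtain ⟨P, hP⟩ : ∃ P, P = 2 * ⌈(36 * k : ℝ) * Real.log (12 * k)⌉₊ := ⟨_, rfl⟩
  obtain ⟨hP0, hnum⟩ := KDef.numeric k hk P hP
  obtain ⟨s, hs⟩ : ∃ s, s = n / (2 * k) := ⟨_, rfl⟩
  have hsn : n < 2 * k * (s + 1) := by
    rw [hs]; exact Nat.lt_mul_div_succ n (by omega)
  have hPL : P * (Δ + s) ≤ L := by
    have h1 : (s : ℝ) ≤ (n : ℝ) / (2 * k : ℝ) := by
      rw [hs]
      have := @Nat.cast_div_le ℝ _ _ _ n (2 * k)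
      push_cast at this
      exact this
    have h2 : (P : ℝ) = 2 * (⌈(36 * k : ℝ) * Real.log (12 * k)⌉₊ : ℝ) := by
      rw [hP]; push_cast; ring
    rw [← h2] at hL
    have : ((P * (Δ + s) : ℕ) : ℝ) ≤ (L : ℝ) := by
      push_cast
      refine le_trans ?_ hL
      gcongr
    exact_mod_cast this
  set H := KDef.ext G with hH
  set τ : ℕ → ℕ := fun φ => φ * (Δ + s) + Δ with hτ
  set ok : ℕ → ℕ → ℕ → Prop := fun φ i j => (H (τ φ + i)).Adj (w j) (w (j+1)) with hok
  have hφL : ∀ φ, φ < P → (φ + 1) * (Δ + s) ≤ L := fun φ hφ =>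
    (Nat.mul_le_mul_right _ hφ).trans hPL
  obtain ⟨c, hc⟩ := KDef.cover (6 * k) N P (by omega) hP0 (fun φ => KDef.st (ok φ) N s)
    (fun φ _ => rfl) (fun φ hφ => KDef.st_end (ok φ) N s k (by nlinarith) (by
      intro i hi
      have hlt : τ φ + i < L := by
        have := hφL φ hφ
        rw [add_mul] at this
        simp only [hτ]; omega
      have hHt : H (τ φ + i) = G ⟨τ φ + i, hlt⟩ := by
        rw [hH]; unfold KDef.ext; rw [dif_pos hlt]
      have := KDef.blocked_card hw hcnt (hd ⟨τ φ + i, hlt⟩)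
      rw [← hHt] at this
      exact this)) hnum
  have main : ∀ φ, φ ≤ P → ∃ u, KDef.Trav H 0 (φ * (Δ + s)) v u
      {x | ∃ ψ, ψ < φ ∧ ∃ j, KDef.st (ok ψ) N s (c ψ) ≤ j ∧ j < KDef.st (ok ψ) N s (c ψ + 1) ∧
        w j = x} := by
    intro φ
    induction φ with
    | zero =>
      intro _
      exact ⟨v, (KDef.Trav.stay H 0 _ (by simp) v).mono (by rintro x ⟨ψ, h, _⟩; omega)⟩
    | succ φ ih =>
      intro hφ
      obtain ⟨u, hu⟩ := ih (by omega)
      have hl := hφL φ hφ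
      have e1 : (φ + 1) * (Δ + s) = φ * (Δ + s) + Δ + s := by ring
      have A := KDef.trav_of_delta G hΔ (φ * (Δ + s)) (by omega) u
        (w (KDef.st (ok φ) N s (c φ)))
      have B := KDef.trav_run H w N (τ φ) (KDef.st (ok φ) N s (c φ)) s
      rw [e1]
      refine ⟨_, ((hu.trans (Nat.zero_le _) (Nat.le_add_right _ _) A).trans (Nat.zero_le _)
        (Nat.le_add_right _ _) B).mono ?_⟩
      rintro x ⟨ψ, hψ, j, h1, h2, rfl⟩
      rcases Nat.lt_or_ge ψ φ with h | h
      · left; left; exact ⟨ψ, h, j, h1, h2, rfl⟩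
      · have : ψ = φ := by omega
        subst this
        right
        rw [KDef.st] at h2
        exact ⟨j, h1, by change j ≤ KDef.run (ok ψ) N _ s; omega, rfl⟩
  obtain ⟨u, hu⟩ := main P le_rfl
  refine KDef.explore_of_trav G _ hPL v u (hu.mono ?_)
  intro x _
  obtain ⟨j, hj, rfl⟩ := hsurj x
  obtain ⟨φ, h1, h2, h3⟩ := hc j hj
  exact ⟨φ, h1, j, h2, h3, rfl⟩
end

section
/- Let k and n be natural numbers with k ≥ 1 and n ≥ 2, and let 𝒢 be an always-connected, k-edge-deficient temporal graph on n vertices whose lifetime is at least 2·⌈36k·ln(12k)⌉·((n−1) + n/(2k)). Then 𝒢 can be explored from any vertex in at most 2·⌈36k·ln(12k)⌉·((n−1) + n/(2k)) steps (which is O(nk·log k)). -/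
theorem exists_cross {V : Type*} {T : SimpleGraph V} (hT : T.Connected) (S : Set V) (r : V)
    (hr : r ∈ S) (z : V) (hz : z ∉ S) : ∃ x ∈ S, ∃ y, y ∉ S ∧ T.Adj x y := by
  obtain ⟨w⟩ := hT.preconnected r z
  obtain ⟨d, -, h1, h2⟩ := w.exists_boundary_dart S hr hz
  exact ⟨_, h1, _, h2, d.adj⟩

open Classical in
theorem tour_aux {V : Type*} [Fintype V] {T : SimpleGraph V} (hT : T.Connected) (r : V)
    (q : ℕ) (hq : q + 1 ≤ Fintype.card V) :
    ∃ p : T.Walk r r, p.support.toFinset.card = q + 1 ∧ p.length = 2 * q ∧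
      ∀ e, p.edges.count e ≤ 2 := by
  induction q with
  | zero => exact ⟨.nil, by simp, by simp, by simp⟩
  | succ q ih =>
    obtain ⟨p, h1, h2, h3⟩ := ih (by omega)
    have : ∃ z, z ∉ p.support := by
      by_contra! h
      have : p.support.toFinset = Finset.univ := by ext; simp [h]
      rw [this, Finset.card_univ] at h1
      omega
    obtain ⟨z, hz⟩ := this
    obtain ⟨x, hx, y, hy, hxy⟩ := exists_cross hT {x | x ∈ p.support} r (by simp) z hz
    simp only [Set.mem_ofPred_eq] at hx hy
    have key := p.take_spec hx
    set p1 := p.takeUntil x hx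
    set p2 := p.dropUntil x hx
    refine ⟨p1.append (.cons hxy (.cons hxy.symm p2)), ?_, ?_, ?_⟩
    · have : (p1.append (.cons hxy (.cons hxy.symm p2))).support.toFinset
          = insert y p.support.toFinset := by
        ext a
        rw [← key]
        simp only [List.mem_toFinset, SimpleGraph.Walk.mem_support_append_iff,
          SimpleGraph.Walk.support_cons, List.mem_cons, Finset.mem_insert]
        constructor
        · rintro (h | h | h | h) <;> simp_all
        · rintro (h | h | h) <;> simp_all
      rw [this, Finset.card_insert_of_notMem (by simpa using hy), h1]
    · have : p.length = p1.length + p2.length := by rw [← key]; simp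
      simp; omega
    · intro e
      have h := h3 e
      rw [← key] at h
      simp only [SimpleGraph.Walk.edges_append, SimpleGraph.Walk.edges_cons, List.count_append,
        List.count_cons] at h ⊢
      by_cases he : e = s(x, y)
      · have : e ∉ p.edges := by
          subst he
          intro hh
          exact hy (p.snd_mem_support_of_mem_edges hh)
        have := List.count_eq_zero_of_not_mem this
        rw [← key] at this
        simp only [SimpleGraph.Walk.edges_append, List.count_append] at this
        split_ifs <;> omega
      · have h1 : ¬ (s(x, y) = e) := fun h => he h.symm
        have h2 : ¬ (s(y, x) = e) := fun h => he (by rw [← h, Sym2.eq_swap])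
        simp [h1, h2]; omega

open Classical in
theorem tour {V : Type*} [Fintype V] {T : SimpleGraph V} (hT : T.Connected) :
    ∃ c : ℕ → V, (∀ x, ∃ i ≤ 2 * (Fintype.card V - 1), c i = x) ∧
      ∀ (H : SimpleGraph V) (k : ℕ), (T.edgeSet \ H.edgeSet).ncard ≤ k →
        ((Finset.range (2 * (Fintype.card V - 1))).filter
          (fun i => ¬ H.Adj (c i) (c (i + 1)))).card ≤ 2 * k := by
  have := hT.nonempty
  obtain ⟨r⟩ := this
  have hpos : 0 < Fintype.card V := Fintype.card_pos_iff.mpr ⟨r⟩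
  obtain ⟨p, h1, h2, h3⟩ := tour_aux hT r (Fintype.card V - 1) (by omega)
  refine ⟨p.getVert, ?_, ?_⟩
  · intro x
    have : p.support.toFinset = Finset.univ := by
      rw [← Finset.card_eq_iff_eq_univ]; omega
    have hx : x ∈ p.support := by
      rw [← List.mem_toFinset, this]; simp
    obtain ⟨i, hi, hi'⟩ := SimpleGraph.Walk.mem_support_iff_exists_getVert.mp hx
    exact ⟨i, by omega, hi⟩
  · intro H k hk
    have hedges : p.edges = (List.range p.length).map
        (fun i => s(p.getVert i, p.getVert (i+1))) := by
      apply List.ext_getElem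
      · simp
      · intro i h1 h2
        simp [SimpleGraph.Walk.getElem_edges]
    have hfin : (T.edgeSet \ H.edgeSet).Finite := Set.toFinite _
    rw [Set.ncard_eq_toFinset_card _ hfin] at hk
    refine le_trans (Finset.card_le_mul_card_image_of_maps_to
      (f := fun i => s(p.getVert i, p.getVert (i+1))) (t := hfin.toFinset) ?_ 2 ?_) (by omega)
    · intro i hi
      simp only [Finset.mem_filter, Finset.mem_range] at hi
      simp only [Set.Finite.mem_toFinset, Set.mem_sdiff, SimpleGraph.mem_edgeSet]
      exact ⟨p.adj_getVert_succ (by omega), hi.2⟩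
    · intro e _
      refine le_trans ?_ (h3 e)
      rw [hedges, List.count_eq_countP, List.countP_map, List.countP_eq_length_filter]
      rw [Finset.filter_filter, h2]
      have : ((List.range (2 * (Fintype.card V - 1))).filter
          ((fun x => x == e) ∘ fun i => s(p.getVert i, p.getVert (i + 1)))).length
          = ((Finset.range (2 * (Fintype.card V - 1))).filter
            (fun i => s(p.getVert i, p.getVert (i + 1)) = e)).card := by
        rw [← List.toFinset_card_of_nodup (List.nodup_range.filter _)]
        congr 1
        ext i
        simp
      rw [this]
      apply Finset.card_le_card
      intro i hi
      simp only [Finset.mem_filter] at hi ⊢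
      exact ⟨hi.1, hi.2.2⟩

/-- At time `s` one can be at `u` having visited exactly `A`. -/
inductive RW {V : Type*} (H : ℕ → SimpleGraph V) (v : V) : ℕ → V → Set V → Prop
  | start : RW H v 0 v {v}
  | stay {s u A} : RW H v s u A → RW H v (s + 1) u A
  | move {s u A u'} : RW H v s u A → (H s).Adj u u' → RW H v (s + 1) u' (insert u' A)

theorem RW.compress {V : Type*} {H : ℕ → SimpleGraph V} {v : V} {s : ℕ} {u : V} {A : Set V}
    (h : RW H v s u A) : ∃ ℓ ≤ s, ∃ (w : ℕ → V) (t : ℕ → ℕ), (∀ i < ℓ, t i < s) ∧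
      (∀ i j, i < j → j < ℓ → t i < t j) ∧ w 0 = v ∧ w ℓ = u ∧ (∀ x ∈ A, ∃ i ≤ ℓ, w i = x) ∧
      ∀ i < ℓ, (H (t i)).Adj (w i) (w (i + 1)) := by
  induction h with
  | start => exact ⟨0, le_rfl, fun _ => v, fun _ => 0, by simp, by simp, rfl, rfl, by simp, by simp⟩
  | stay _ ih =>
    obtain ⟨ℓ, h1, w, t, h2, h3, h4, h5, h6, h7⟩ := ih
    exact ⟨ℓ, by omega, w, t, fun i hi => by have := h2 i hi; omega, h3, h4, h5, h6, h7⟩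
  | @move s u A u' _ hadj ih =>
    obtain ⟨ℓ, h1, w, t, h2, h3, h4, h5, h6, h7⟩ := ih
    refine ⟨ℓ + 1, by omega, fun i => if i ≤ ℓ then w i else u',
      fun i => if i < ℓ then t i else s, ?_, ?_, ?_, ?_, ?_, ?_⟩
    · intro i hi
      dsimp only
      split_ifs with h
      · have := h2 i h; omega
      · omega
    · intro i j hij hj
      dsimp only
      rw [if_pos (by omega : i < ℓ)]
      split_ifs with h
      · exact h3 i j hij h
      · exact h2 i (by omega)
    · simp [h4]
    · simp
    · intro x hx
      rcases hx with rfl | hx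
      · exact ⟨ℓ + 1, le_rfl, by simp⟩
      · obtain ⟨i, hi, hi'⟩ := h6 x hx
        exact ⟨i, by omega, by simp [hi, hi']⟩
    · intro i hi
      dsimp only
      by_cases h : i < ℓ
      · rw [if_pos h, if_pos h.le, if_pos (by omega)]
        exact h7 i h
      · have : i = ℓ := by omega
        subst this
        simp [h5, hadj]

theorem RW.reach_card {V : Type*} [Fintype V] {H : ℕ → SimpleGraph V} {v : V} {s : ℕ} {u : V}
    {A : Set V} (h : RW H v s u A) (i : ℕ) (hi : i + 1 ≤ Fintype.card V)
    (hc : ∀ j < i, (H (s + j)).Connected) :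
    i + 1 ≤ {y | ∃ A', A ⊆ A' ∧ RW H v (s + i) y A'}.ncard := by
  induction i with
  | zero =>
    rw [Nat.zero_add, Nat.one_le_iff_ne_zero, ← Nat.pos_iff_ne_zero, Set.ncard_pos]
    exact ⟨u, A, le_rfl, h⟩
  | succ i ih =>
    have ih := ih (by omega) (fun j hj => hc j (by omega))
    set B := {y | ∃ A', A ⊆ A' ∧ RW H v (s + i) y A'} with hB
    have hsub : B ⊆ {y | ∃ A', A ⊆ A' ∧ RW H v (s + (i + 1)) y A'} := by
      rintro y ⟨A', h1, h2⟩
      exact ⟨A', h1, h2.stay⟩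
    by_cases hu : B = Set.univ
    · rw [hu, Set.univ_subset_iff] at hsub
      rw [hsub, Set.ncard_univ, Nat.card_eq_fintype_card]
      exact hi
    · obtain ⟨z, hz⟩ := (Set.ne_univ_iff_exists_notMem _).mp hu
      have hne : B.Nonempty := by
        rw [← Set.ncard_pos]; omega
      obtain ⟨r, hr⟩ := hne
      obtain ⟨x, ⟨A', hx1, hx2⟩, y, hy, hxy⟩ := exists_cross (hc i (by omega)) B r hr z hz
      have : insert y B ⊆ {y | ∃ A', A ⊆ A' ∧ RW H v (s + (i + 1)) y A'} := by
        apply Set.insert_subset _ hsub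
        exact ⟨_, hx1.trans (Set.subset_insert _ _), hx2.move hxy⟩
      have h2 := Set.ncard_le_ncard this
      rw [Set.ncard_insert_of_notMem hy] at h2
      omega

theorem RW.reach {V : Type*} [Fintype V] {H : ℕ → SimpleGraph V} {v : V} {s : ℕ} {u : V}
    {A : Set V} (h : RW H v s u A) 
    (hc : ∀ j < Fintype.card V - 1, (H (s + j)).Connected) (y : V) :
    ∃ A', A ⊆ A' ∧ RW H v (s + (Fintype.card V - 1)) y A' := by
  have hpos : 0 < Fintype.card V := Fintype.card_pos_iff.mpr ⟨y⟩
  have := h.reach_card (Fintype.card V - 1) (by omega) hc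
  have h2 : {y | ∃ A', A ⊆ A' ∧ RW H v (s + (Fintype.card V - 1)) y A'} = Set.univ := by
    apply Set.eq_of_subset_of_ncard_le (Set.subset_univ _)
    rw [Set.ncard_univ, Nat.card_eq_fintype_card]
    omega
  have : y ∈ (Set.univ : Set V) := trivial
  rw [← h2] at this
  exact this

open Classical in
/-- position along the tour `c` (of length `m`) after `i` steps from index `x`, starting at time `b` -/
noncomputable def apos {V : Type*} (H : ℕ → SimpleGraph V) (c : ℕ → V) (m b x : ℕ) : ℕ → ℕ
  | 0 => x
  | i + 1 => if apos H c m b x i < m ∧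
      (H (b + i)).Adj (c (apos H c m b x i)) (c (apos H c m b x i + 1))
      then apos H c m b x i + 1 else apos H c m b x i

theorem apos_mono {V : Type*} (H : ℕ → SimpleGraph V) (c : ℕ → V) (m b x : ℕ) :
    Monotone (apos H c m b x) := by
  apply monotone_nat_of_le_succ
  intro i
  rw [apos]; split_ifs <;> omega

theorem le_apos {V : Type*} (H : ℕ → SimpleGraph V) (c : ℕ → V) (m b x i : ℕ) :
    x ≤ apos H c m b x i := apos_mono H c m b x (Nat.zero_le i)

theorem apos_le {V : Type*} (H : ℕ → SimpleGraph V) (c : ℕ → V) (m b x i : ℕ) :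
    apos H c m b x i ≤ max x m := by
  induction i with
  | zero => simp [apos]
  | succ i ih => rw [apos]; split_ifs <;> omega

theorem RW.agent {V : Type*} {H : ℕ → SimpleGraph V} {v : V} {b : ℕ} (c : ℕ → V) (m x : ℕ)
    {A : Set V} (h : RW H v b (c x) A) (i : ℕ) :
    ∃ A', A ⊆ A' ∧ RW H v (b + i) (c (apos H c m b x i)) A' ∧
      ∀ j, x ≤ j → j ≤ apos H c m b x i → j = x ∨ c j ∈ A' := by
  induction i with
  | zero => exact ⟨A, le_rfl, h, fun j h1 h2 => by simp [apos] at h2; left; omega⟩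
  | succ i ih =>
    obtain ⟨A', h1, h2, h3⟩ := ih
    rw [apos]
    split_ifs with hh
    · refine ⟨_, h1.trans (Set.subset_insert _ _), h2.move hh.2, fun j hj1 hj2 => ?_⟩
      rcases Nat.lt_or_ge (apos H c m b x i) j with hj | hj
      · have : j = apos H c m b x i + 1 := by omega
        right; left; rw [this]
      · rcases h3 j hj1 hj with h | h
        · exact .inl h
        · exact .inr (.inr h)
    · exact ⟨A', h1, h2.stay, h3⟩

theorem RW.mem {V : Type*} {H : ℕ → SimpleGraph V} {v : V} {s : ℕ} {u : V} {A : Set V}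
    (h : RW H v s u A) : u ∈ A := by
  induction h with
  | start => rfl
  | stay _ ih => exact ih
  | move => exact Set.mem_insert _ _

theorem RW.phase {V : Type*} [Fintype V] {H : ℕ → SimpleGraph V} {v : V} {s : ℕ} {u : V}
    {A : Set V} (h : RW H v s u A) (d : ℕ) (hd : d = Fintype.card V - 1)
    (hc : ∀ j < d, (H (s + j)).Connected) (c : ℕ → V) (m x : ℕ) :
    ∃ u' A', A ⊆ A' ∧ RW H v (s + d + d) u' A' ∧
      ∀ j, x ≤ j → j ≤ apos H c m (s + d) x d → c j ∈ A' := by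
  subst hd
  obtain ⟨A1, h1, h2⟩ := h.reach hc (c x)
  obtain ⟨A2, h3, h4, h5⟩ := h2.agent c m x (Fintype.card V - 1)
  refine ⟨_, A2, h1.trans h3, h4, fun j hj1 hj2 => ?_⟩
  rcases h5 j hj1 hj2 with rfl | h
  · exact h3 h2.mem
  · exact h

theorem RW.phases {V : Type*} [Fintype V] {H : ℕ → SimpleGraph V} {v : V} 
    (d : ℕ) (hd : d = Fintype.card V - 1) (N : ℕ)
    (hc : ∀ j < N * (2 * d), (H j).Connected) (c : ℕ → V) (m : ℕ) (x : ℕ → ℕ) (r : ℕ) (hr : r ≤ N) :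
    ∃ u A, RW H v (r * (2 * d)) u A ∧
      ∀ t < r, ∀ j, x t ≤ j → j ≤ apos H c m (t * (2 * d) + d) (x t) d → c j ∈ A := by
  induction r with
  | zero => exact ⟨v, {v}, by simpa using RW.start, by simp⟩
  | succ r ih =>
    obtain ⟨u, A, h1, h2⟩ := ih (by omega)
    have hle : (r + 1) * (2 * d) ≤ N * (2 * d) := Nat.mul_le_mul_right _ hr
    have he : (r + 1) * (2 * d) = r * (2 * d) + d + d := by ring
    obtain ⟨u', A', h3, h4, h5⟩ := h1.phase d hd (fun j hj => hc _ (by omega)) c m (x r)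
    refine ⟨u', A', he ▸ h4, fun t ht j hj1 hj2 => ?_⟩
    rcases Nat.lt_succ_iff_lt_or_eq.mp ht with ht | rfl
    · exact h3 (h2 t ht j hj1 hj2)
    · exact h5 j hj1 hj2

open Classical in
/-- A blocked agent accounts for blocked (time, edge) pairs. -/
theorem agent_blocked {V : Type*} (H : ℕ → SimpleGraph V) (c : ℕ → V) (m b x y d : ℕ)
    (hy : y ≤ m) (h : apos H c m b x d < y) :
    d ≤ (((Finset.range d) ×ˢ (Finset.range m)).filter (fun q => ¬ (H (b + q.1)).Adj (c q.2) (c (q.2+1))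
      ∧ x ≤ q.2 ∧ q.2 < y)).card + (y - x) := by
  have h1 : ∀ i, apos H c m b x i = x + ((Finset.range i).filter
      (fun i => apos H c m b x (i+1) ≠ apos H c m b x i)).card := by
    intro i
    induction i with
    | zero => simp [apos]
    | succ i ih =>
      rw [Finset.range_add_one, Finset.filter_insert]
      split_ifs with hh
      · rw [Finset.card_insert_of_notMem (by simp), ← add_assoc, ← ih]
        rw [apos] at hh ⊢
        split_ifs at hh ⊢ <;> omega
      · rw [← ih]; simpa using hh
  have h2 := Finset.card_filter_add_card_filter_not (s := Finset.range d)
    (fun i => apos H c m b x (i+1) ≠ apos H c m b x i)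
  have h3 := h1 d
  have h4 : ((Finset.range d).filter (fun i => ¬ (apos H c m b x (i+1) ≠ apos H c m b x i))).card ≤
      (((Finset.range d) ×ˢ (Finset.range m)).filter (fun q => ¬ (H (b + q.1)).Adj (c q.2) (c (q.2+1))
      ∧ x ≤ q.2 ∧ q.2 < y)).card := by
    apply Finset.card_le_card_of_injOn (fun i => (i, apos H c m b x i))
    · intro i hi
      simp only [Finset.coe_filter, Finset.mem_range, Set.mem_ofPred_eq, not_not] at hi
      have hi1 := apos_mono H c m b x hi.1.le
      have hi2 := le_apos H c m b x i
      simp only [Finset.coe_filter, Finset.mem_product, Finset.mem_range, Set.mem_ofPred_eq]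
      refine ⟨⟨hi.1, by omega⟩, ?_, hi2, by omega⟩
      intro hadj
      have := hi.2
      rw [apos, if_pos ⟨by omega, hadj⟩] at this
      omega
    · intro i _ j _ hij
      exact (Prod.ext_iff.mp hij).1
  rw [Finset.card_range] at h2
  omega

theorem pieces (f : ℕ → ℕ → ℕ) (m N R : ℕ) (hN : 0 < N) (hf1 : ∀ t x, x ≤ f t x)
    (hf2 : ∀ t x, f t x ≤ max x m)
    (hR : ∀ t < N, ∀ a : ℕ → ℕ, StrictMono a → a (2 * R) ≤ m →
      ((Finset.range (2 * R)).filter (fun j => f t (a j) < a (j + 1))).card ≤ R)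
    (hR0 : 0 < R) :
    ∃ a : ℕ → ℕ, a 0 = 0 ∧ m < a (2 * R) ∧
      ∀ j, N ≤ 2 * ((Finset.range N).filter (fun t => a (j + 1) ≤ f t (a j) + 1)).card := by
  have hh : ∀ x, ∃ y, x < y ∧ N < 2 * ((Finset.range N).filter (fun t => f t x < y)).card ∧
      N ≤ 2 * ((Finset.range N).filter (fun t => y ≤ f t x + 1)).card := by
    intro x
    have hex : ∃ y, N < 2 * ((Finset.range N).filter (fun t => f t x < y)).card := by
      refine ⟨max x m + 1, ?_⟩
      rw [Finset.filter_true_of_mem (fun t _ => by have := hf2 t x; omega), Finset.card_range]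
      omega
    classical
    have h1 := Nat.find_spec hex
    have h2 := fun y => Nat.find_min (H := hex) (m := y)
    set y := Nat.find hex
    have hxy : x < y := by
      by_contra hcon
      rw [Finset.filter_false_of_mem (fun t _ => by have := hf1 t x; omega)] at h1
      simp at h1
    refine ⟨y, hxy, h1, ?_⟩
    have h3 := h2 (y - 1) (by omega)
    have h4 := Finset.card_filter_add_card_filter_not (s := Finset.range N)
      (fun t => f t x < y - 1)
    have h5 : (Finset.range N).filter (fun t => ¬ f t x < y - 1) =
        (Finset.range N).filter (fun t => y ≤ f t x + 1) := by
      apply Finset.filter_congr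
      intro t _
      omega
    rw [h5, Finset.card_range] at h4
    omega
  choose h h1 h2 h3 using hh
  have hs : ∀ j, h^[j + 1] 0 = h (h^[j] 0) := fun j => Function.iterate_succ_apply' h j 0
  refine ⟨fun j => h^[j] 0, rfl, ?_, fun j => ?_⟩
  · by_contra hcon
    have hmono : StrictMono (fun j => h^[j] 0) := strictMono_nat_of_lt_succ (fun j => by
      rw [hs]; exact h1 _)
    have hRR := fun t ht => hR t ht _ hmono (not_lt.mp hcon)
    have e1 : ∑ t ∈ Finset.range N, ((Finset.range (2 * R)).filter
        (fun j => f t (h^[j] 0) < h^[j + 1] 0)).card ≤ N * R := by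
      have := Finset.sum_le_card_nsmul (Finset.range N) (fun t => ((Finset.range (2 * R)).filter
        (fun j => f t (h^[j] 0) < h^[j + 1] 0)).card) R
          (fun t ht => hRR t (Finset.mem_range.mp ht))
      simpa using this
    have e2 : ∑ t ∈ Finset.range N, ((Finset.range (2 * R)).filter
        (fun j => f t (h^[j] 0) < h^[j + 1] 0)).card = ∑ j ∈ Finset.range (2 * R),
        ((Finset.range N).filter (fun t => f t (h^[j] 0) < h^[j + 1] 0)).card := by
      simp only [Finset.card_filter]
      exact Finset.sum_comm
    have e3 : ∑ j ∈ Finset.range (2 * R), N < ∑ j ∈ Finset.range (2 * R),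
        2 * ((Finset.range N).filter (fun t => f t (h^[j] 0) < h^[j + 1] 0)).card := by
      apply Finset.sum_lt_sum_of_nonempty
      · simp; omega
      · intro j _
        rw [hs]; exact h2 _
    rw [← Finset.mul_sum, ← e2] at e3
    simp only [Finset.sum_const, Finset.card_range, smul_eq_mul] at e3
    nlinarith
  · simp only [hs]
    exact h3 _

open Classical in
theorem blocked_bound {V : Type*} (H : ℕ → SimpleGraph V) (c : ℕ → V) (b d k : ℕ) (hd : 0 < d)
    (hb : ∀ i < d, ((Finset.range (2 * d)).filter
          (fun e => ¬ (H (b + i)).Adj (c e) (c (e + 1)))).card ≤ 2 * k)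
    (K : ℕ) (a : ℕ → ℕ) (ha : StrictMono a) (haK : a K ≤ 2 * d) :
    ((Finset.range K).filter (fun j => apos H c (2 * d) b (a j) d < a (j + 1))).card
      ≤ 2 * k + 2 := by
  set J := (Finset.range K).filter (fun j => apos H c (2 * d) b (a j) d < a (j + 1)) with hJ
  set P : ℕ → Finset (ℕ × ℕ) := fun j => ((Finset.range d) ×ˢ (Finset.range (2 * d))).filter
    (fun q => ¬ (H (b + q.1)).Adj (c q.2) (c (q.2+1)) ∧ a j ≤ q.2 ∧ q.2 < a (j + 1)) with hP
  set BL := ((Finset.range d) ×ˢ (Finset.range (2 * d))).filter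
    (fun q => ¬ (H (b + q.1)).Adj (c q.2) (c (q.2+1))) with hBL
  have h1 : ∀ j ∈ J, d ≤ (P j).card + (a (j + 1) - a j) := by
    intro j hj
    rw [hJ, Finset.mem_filter, Finset.mem_range] at hj
    exact agent_blocked H c (2 * d) b (a j) (a (j + 1)) d
      ((ha.monotone (by omega : j + 1 ≤ K)).trans haK) hj.2
  have h2 : ∑ j ∈ J, (P j).card ≤ BL.card := by
    rw [← Finset.card_biUnion]
    · apply Finset.card_le_card
      intro q hq
      simp only [Finset.mem_biUnion, hP, Finset.mem_filter] at hq
      obtain ⟨j, -, hq⟩ := hq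
      rw [hBL, Finset.mem_filter]
      exact ⟨hq.1, hq.2.1⟩
    · intro i _ j _ hij
      rw [Function.onFun, Finset.disjoint_left]
      intro q hq1 hq2
      simp only [hP, Finset.mem_filter] at hq1 hq2
      rcases Nat.lt_or_gt_of_ne hij with h | h
      · have := ha.monotone (by omega : i + 1 ≤ j)
        omega
      · have := ha.monotone (by omega : j + 1 ≤ i)
        omega
  have h3 : BL.card ≤ d * (2 * k) := by
    have : BL.card = ∑ i ∈ Finset.range d, ((Finset.range (2 * d)).filter
          (fun e => ¬ (H (b + i)).Adj (c e) (c (e + 1)))).card := by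
      simp only [hBL, Finset.card_filter]
      rw [Finset.sum_product]
    rw [this]
    have := Finset.sum_le_card_nsmul (Finset.range d) _ (2 * k)
      (fun i hi => hb i (Finset.mem_range.mp hi))
    simpa using this
  have h4 : ∑ j ∈ J, (a (j + 1) - a j) ≤ 2 * d := by
    calc _ ≤ ∑ j ∈ Finset.range K, (a (j + 1) - a j) :=
          Finset.sum_le_sum_of_subset (Finset.filter_subset _ _)
      _ = a K - a 0 := Finset.sum_range_tsub ha.monotone K
      _ ≤ _ := by omega
  have h5 : J.card * d ≤ ∑ j ∈ J, ((P j).card + (a (j + 1) - a j)) := by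
    have := Finset.card_nsmul_le_sum J _ d h1
    simpa using this
  rw [Finset.sum_add_distrib] at h5
  have h6 : J.card * d ≤ (2 * k + 2) * d := by nlinarith
  exact Nat.le_of_mul_le_mul_right h6 hd

theorem explore_main {V : Type*} [Fintype V] (H : ℕ → SimpleGraph V) (T : SimpleGraph V)
    (hT : T.Connected) (k d N : ℕ) (hd : d = Fintype.card V - 1) (hd0 : 0 < d)
    (hN : 8 * k + 8 ≤ N)
    (hc : ∀ j < N * (2 * d), (H j).Connected)
    (hdef : ∀ j < N * (2 * d), KDeficientWrt T (H j) k) (v : V) :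
    ∃ u, RW H v (N * (2 * d)) u Set.univ := by
  obtain ⟨c, hc1, hc2⟩ := tour hT
  rw [← hd] at hc1 hc2
  obtain ⟨a, ha0, haK, ha⟩ := pieces (fun t x => apos H c (2 * d) (t * (2 * d) + d) x d) (2 * d) N
    (2 * k + 2) (by omega) (fun t x => le_apos ..) (fun t x => apos_le ..) (by
      intro t ht a ha haK
      refine blocked_bound H c _ d k hd0 (fun i hi => ?_) _ a ha haK
      have hle : (t + 1) * (2 * d) ≤ N * (2 * d) := Nat.mul_le_mul_right _ ht
      have he : (t + 1) * (2 * d) = t * (2 * d) + d + d := by ring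
      have hlt : t * (2 * d) + d + i < N * (2 * d) := by omega
      convert hc2 (H (t * (2 * d) + d + i)) k (hdef _ hlt)) (by omega)
  set K := 2 * (2 * k + 2) with hK
  obtain ⟨σ, hσ1, hσ2⟩ := (Finset.all_card_le_biUnion_card_iff_exists_injective
    (fun j : Fin K => (Finset.range N).filter
      (fun t => a (j + 1) ≤ apos H c (2 * d) (t * (2 * d) + d) (a j) d + 1))).mp (by
      intro s
      rcases s.eq_empty_or_nonempty with rfl | ⟨j, hj⟩
      · simp
      · have h1 := Finset.card_le_univ s
        rw [Fintype.card_fin] at h1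
        have h2 := ha j
        have h3 := Finset.card_le_card (Finset.subset_biUnion_of_mem (fun j : Fin K =>
          (Finset.range N).filter
          (fun t => a (j + 1) ≤ apos H c (2 * d) (t * (2 * d) + d) (a j) d + 1)) hj)
        omega)
  classical
  let x : ℕ → ℕ := fun t => if h : ∃ j, σ j = t then a h.choose else 0
  have hx : ∀ j, x (σ j) = a j := by
    intro j
    have h : ∃ j', σ j' = σ j := ⟨j, rfl⟩
    have h2 : h.choose = j := hσ1 h.choose_spec
    simp only [x]
    rw [dif_pos h, h2]
  obtain ⟨u, A, h1, h2⟩ := RW.phases (v := v) d hd N hc c (2 * d) x N le_rfl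
  refine ⟨u, ?_⟩
  have : A = Set.univ := by
    rw [Set.eq_univ_iff_forall]
    intro y
    obtain ⟨i, hi, rfl⟩ := hc1 y
    have hex : ∃ j, i < a j := ⟨K, by omega⟩
    have hf1 := Nat.find_spec hex
    have hf2 := fun j => Nat.find_min (H := hex) (m := j)
    have hf3 : Nat.find hex ≤ K := Nat.find_min' hex (by omega)
    have hf4 : Nat.find hex ≠ 0 := fun h => by rw [h] at hf1; omega
    obtain ⟨j, hj⟩ := Nat.exists_eq_succ_of_ne_zero hf4
    rw [hj] at hf1 hf2 hf3
    have hlt := hf2 j (by omega)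
    have hs := hσ2 ⟨j, by omega⟩
    rw [Finset.mem_filter, Finset.mem_range] at hs
    refine h2 _ hs.1 i ?_ ?_
    · rw [hx]; simp only; omega
    · rw [hx]
      have := hs.2
      simp only [Nat.succ_eq_add_one] at this hf1 ⊢
      omega
  rwa [← this]

/-- **Corollary (paper).** An always-connected `k`-edge-deficient temporal graph on
`n ≥ 2` vertices with lifetime at least `2⌈36k ln(12k)⌉ ((n-1) + n/(2k))` can be
explored from any vertex in at most `2⌈36k ln(12k)⌉ ((n-1) + n/(2k))` steps
(which is `O(nk log k)`). -/
theorem kDef_always_connected_exploration (k n L : ℕ) (hk : 1 ≤ k) (hn2 : 2 ≤ n)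
    (V : Type*) [Fintype V] (hn : Fintype.card V = n)
    (G : Fin L → SimpleGraph V)
    (hconn : ∀ t : Fin L, (G t).Connected)
    (hdef : ∃ T : SimpleGraph V, IsSpanningTree T (⨆ t, G t) ∧
      ∀ t : Fin L, KDeficientWrt T (G t) k)
    (hL : 2 * (⌈(36 * k : ℝ) * Real.log (12 * k)⌉₊ : ℝ) *
        (((n : ℝ) - 1) + (n : ℝ) / (2 * k : ℝ)) ≤ (L : ℝ)) :
    ∀ v : V, ∃ ℓ : ℕ,
      (ℓ : ℝ) ≤ 2 * (⌈(36 * k : ℝ) * Real.log (12 * k)⌉₊ : ℝ) *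
        (((n : ℝ) - 1) + (n : ℝ) / (2 * k : ℝ)) ∧
      ExploresIn G v ℓ := by
  intro v
  classical
  obtain ⟨T, ⟨-, hT⟩, hTd⟩ := hdef
  set N := ⌈(36 * k : ℝ) * Real.log (12 * k)⌉₊ with hNdef
  have hk1 : (1 : ℝ) ≤ k := by exact_mod_cast hk
  have hlog : (1 : ℝ) ≤ Real.log (12 * k) := by
    rw [Real.le_log_iff_exp_le (by positivity)]
    have := Real.exp_one_lt_d9
    linarith
  have hN : 36 * k ≤ N := by
    have h1 : (36 * k : ℝ) * Real.log (12 * k) ≤ N := Nat.le_ceil _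
    have h2 : (36 * k : ℝ) * 1 ≤ (36 * k : ℝ) * Real.log (12 * k) :=
      mul_le_mul_of_nonneg_left hlog (by positivity)
    have : (36 * k : ℝ) ≤ N := by linarith
    exact_mod_cast this
  have hbound : ((N * (2 * (n - 1)) : ℕ) : ℝ) ≤ 2 * (N : ℝ) *
        (((n : ℝ) - 1) + (n : ℝ) / (2 * k : ℝ)) := by
    push_cast [Nat.cast_sub (by omega : 1 ≤ n)]
    have : 0 ≤ 2 * (N : ℝ) * ((n : ℝ) / (2 * k : ℝ)) := by positivity
    nlinarith
  have hNL : N * (2 * (n - 1)) ≤ L := by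
    exact_mod_cast hbound.trans hL
  let H : ℕ → SimpleGraph V := fun s => if h : s < L then G ⟨s, h⟩ else ⊤
  have hH : ∀ s (h : s < L), H s = G ⟨s, h⟩ := fun s h => dif_pos h
  obtain ⟨u, hu⟩ := explore_main H T hT.connected k (n - 1) N (by rw [hn]) (by omega) (by omega)
    (fun j hj => by rw [hH j (by omega)]; exact hconn _)
    (fun j hj => by rw [hH j (by omega)]; exact hTd _) v
  obtain ⟨ℓ, h1, w, t, h2, h3, h4, h5, h6, h7⟩ := hu.compress
  refine ⟨ℓ, le_trans (by exact_mod_cast h1) hbound, fun i => w i,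
    fun i => ⟨t i, by have := h2 i i.2; omega⟩, ?_, ?_, ?_, ?_⟩
  · intro i j hij
    exact h3 i j hij j.2
  · simpa using h4
  · intro x
    obtain ⟨i, hi, hi'⟩ := h6 x trivial
    exact ⟨⟨i, by omega⟩, hi'⟩
  · intro i
    have := h7 i i.2
    rw [hH _ (by have := h2 i i.2; omega)] at this
    simpa using this
end
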